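/- Let (X,T) be a minimal t.d.s., let x ∈ X and let d ≥ 1 be an integer. The following statements are equivalent: (1) x is a d-step almost automorphic point, i.e. the only y ∈ X with (x,y) ∈ RP^[d] is y = x; (2) for every open neighborhood V of x, the set N(x,V) intersects every set of d-recurrence; (3) for every open neighborhood V of x, the set N(x,V) intersects every set of d-topological recurrence. -/

import Mathlib

open scoped Classical
open MeasureTheory Filter Topology

noncomputable section

/-- Integer iterate of a bijection `T` of a set: `zIter T n = T^n`. -/
def zIter {X : Type*} (T : Equiv.Perm X) (n : ℤ) : X → X := ⇑(T ^ n)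

/-- Integer iterate of a homeomorphism. -/
def hIter {X : Type*} [TopologicalSpace X] (T : X ≃ₜ X) (n : ℤ) : X → X :=
  zIter T.toEquiv n

/-- The integer nearest to `a`, with ties broken towards the smaller integer.
This is the `⌈·⌉` of the paper. -/
def nearInt (a : ℝ) : ℤ := if a - (⌊a⌋ : ℝ) ≤ 1/2 then ⌊a⌋ else ⌈a⌉

/-- The distance from `a` to the nearest integer, i.e. `‖a‖` in the paper. -/
def distInt (a : ℝ) : ℝ := |a - (nearInt a : ℝ)|

/-- Generalized polynomials of degree at most `d` (for `d ≥ 1`):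
`GP 1` is the smallest collection of functions `ℤ → ℝ` containing `n ↦ a n`
and closed under taking the nearest integer, scalar multiplication and finite sums;
`GP d` moreover contains every `GP e` for `e < d` and all functions
`n ↦ a₀ n^{p₀} ⌈f₁(n)⌉ ⋯ ⌈f k (n)⌉` with `f l ∈ GP (p l)` and `p₀ + ∑ p l = d`. -/
inductive GP : ℕ → (ℤ → ℝ) → Prop
  | lin (a : ℝ) : GP 1 (fun n => a * n)
  | mono {d : ℕ} (hd : 1 ≤ d) (a₀ : ℝ) (p₀ : ℕ) {k : ℕ} (p : Fin k → ℕ)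
      (f : Fin k → ℤ → ℝ) (hf : ∀ l, GP (p l) (f l)) (hsum : p₀ + ∑ l, p l = d) :
      GP d (fun n => a₀ * (n : ℝ) ^ p₀ * ∏ l, (nearInt (f l n) : ℝ))
  | incl {d e : ℕ} (hed : e < d) {f : ℤ → ℝ} (hf : GP e f) : GP d f
  | ceil {d : ℕ} {f : ℤ → ℝ} (hf : GP d f) : GP d (fun n => (nearInt (f n) : ℝ))
  | smul {d : ℕ} (c : ℝ) {f : ℤ → ℝ} (hf : GP d f) : GP d (fun n => c * f n)
  | add {d : ℕ} {f g : ℤ → ℝ} (hf : GP d f) (hg : GP d g) : GP d (fun n => f n + g n)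

/-- The bracket expression `L(a₁, …, a_ℓ) = a₁⌈L(a₂, …, a_ℓ)⌉`, `L(a) = a`. -/
def Lfun : List ℝ → ℝ
  | [] => 0
  | [a] => a
  | a :: b :: rest => a * (nearInt (Lfun (b :: rest)) : ℝ)

/-- Special generalized polynomials of degree at most `d`:
the functions `n ↦ L(n^{j₁} a₁, …, n^{j_ℓ} a_ℓ)` with `1 ≤ ℓ`, `j t ≥ 1`, `∑ j t ≤ d`. -/
def SGP (d : ℕ) (g : ℤ → ℝ) : Prop :=
  ∃ ℓ : ℕ, 1 ≤ ℓ ∧ ∃ (a : Fin ℓ → ℝ) (j : Fin ℓ → ℕ),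
    (∀ t, 1 ≤ j t) ∧ (∑ t, j t) ≤ d ∧
    g = fun n : ℤ => Lfun (List.ofFn fun t => (n : ℝ) ^ (j t) * a t)

/-- `FS({n i}) = {n_{i₁} + ⋯ + n_{i_k} : i₁ < ⋯ < i_k}`, the set of finite sums. -/
def FS {d : ℕ} (n : Fin d → ℤ) : Set ℤ :=
  { m | ∃ I : Finset (Fin d), I.Nonempty ∧ m = ∑ i ∈ I, n i }

/-- `SG d P`: sums `p_{i₁} + ⋯ + p_{i_k}` over strictly increasing finite index
sequences whose consecutive gaps are at most `d` (infinite sequence `P`). -/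
def SG (d : ℕ) (P : ℕ → ℤ) : Set ℤ :=
  { n | ∃ k : ℕ, ∃ i : Fin (k + 1) → ℕ, StrictMono i ∧
      (∀ t : Fin k, i t.succ - i t.castSucc ≤ d) ∧ n = ∑ t, P (i t) }

/-- `SGfin d P` : the same for a finite sequence `P` of length `m`. -/
def SGfin (d : ℕ) {m : ℕ} (P : Fin m → ℤ) : Set ℤ :=
  { n | ∃ k : ℕ, ∃ i : Fin (k + 1) → Fin m, StrictMono i ∧
      (∀ t : Fin k, (i t.succ : ℕ) - (i t.castSucc : ℕ) ≤ d) ∧ n = ∑ t, P (i t) }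

/-- A set of integers is syndetic if it has bounded gaps. -/
def Syndetic (A : Set ℤ) : Prop :=
  ∃ N : ℕ, ∀ i : ℤ, ∃ j, i ≤ j ∧ j ≤ i + N ∧ j ∈ A

/-- `F` has positive upper Banach density. -/
def PosUpperBanachDensity (F : Set ℤ) : Prop :=
  ∃ δ : ℝ, 0 < δ ∧ ∀ N : ℕ, ∃ (a : ℤ) (L : ℕ), N ≤ L ∧ 1 ≤ L ∧
    δ * L ≤ ((Finset.Icc a (a + L - 1)).filter (fun x => x ∈ F)).card

/-- A set `A ⊆ ℤ` contains finite IP-sets of arbitrarily long lengths. -/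
def ContainsArbLongFIP (A : Set ℤ) : Prop :=
  ∀ k : ℕ, 1 ≤ k → ∃ p : Fin k → ℤ, FS p ⊆ A

/-- A topological dynamical system `(X, T)` is minimal: every orbit is dense. -/
def MinimalTDS {X : Type*} [TopologicalSpace X] (T : X ≃ₜ X) : Prop :=
  ∀ x : X, Dense (Set.range fun n : ℤ => hIter T n x)

/-- `Nset T x U = N(x, U) = {n ∈ ℤ : Tⁿ x ∈ U}`. -/
def Nset {X : Type*} [TopologicalSpace X] (T : X ≃ₜ X) (x : X) (U : Set X) : Set ℤ :=
  { n : ℤ | hIter T n x ∈ U }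

/-- The regionally proximal relation of order `d`. -/
def RPd {X : Type*} [MetricSpace X] (T : X ≃ₜ X) (d : ℕ) (x y : X) : Prop :=
  ∀ δ : ℝ, 0 < δ → ∃ (x' y' : X) (n : Fin d → ℤ),
    dist x x' < δ ∧ dist y y' < δ ∧
    ∀ ε : Finset (Fin d), ε.Nonempty →
      dist (hIter T (∑ i ∈ ε, n i) x') (hIter T (∑ i ∈ ε, n i) y') < δ

/-- `S` is a set of `d`-topological recurrence. -/
def TopRecSet (d : ℕ) (S : Set ℤ) : Prop :=
  ∀ (X : Type) [MetricSpace X] [CompactSpace X] (T : X ≃ₜ X), MinimalTDS T →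
    ∀ U : Set X, IsOpen U → U.Nonempty →
      ∃ n ∈ S, (⋂ j ∈ Finset.range (d + 1), hIter T ((j : ℤ) * n) ⁻¹' U).Nonempty

/-- `S` is a set of `d`-recurrence (measurable recurrence). -/
def MeasRecSet (d : ℕ) (S : Set ℤ) : Prop :=
  ∀ (Y : Type) [MeasurableSpace Y] [StandardBorelSpace Y]
    (μ : Measure Y) [IsProbabilityMeasure μ] (T : Y ≃ᵐ Y),
    MeasurePreserving (⇑T) μ μ →
    ∀ A : Set Y, MeasurableSet A → 0 < μ A →
      ∃ n ∈ S, 0 < μ (⋂ j ∈ Finset.range (d + 1), zIter T.toEquiv ((j : ℤ) * n) ⁻¹' A)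

/-- `P` is a Birkhoff recurrence set of order `d`. -/
def BirkhoffRecSet (d : ℕ) (P : Set ℤ) : Prop :=
  ∀ (X : Type) [MetricSpace X] [CompactSpace X] (T : X ≃ₜ X), MinimalTDS T →
    ∀ U : Set X, IsOpen U → U.Nonempty →
      ∃ n : Fin d → ℤ, FS n ⊆ P ∧ (U ∩ ⋂ m ∈ FS n, hIter T m ⁻¹' U).Nonempty

/-- `F` is a Poincaré recurrence set of order `d`. -/
def PoincareRecSet (d : ℕ) (F : Set ℤ) : Prop :=
  ∀ (Y : Type) [MeasurableSpace Y] [StandardBorelSpace Y]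
    (μ : Measure Y) [IsProbabilityMeasure μ] (T : Y ≃ᵐ Y),
    MeasurePreserving (⇑T) μ μ →
    ∀ A : Set Y, MeasurableSet A → 0 < μ A →
      ∃ n : Fin d → ℤ, FS n ⊆ F ∧ 0 < μ (A ∩ ⋂ m ∈ FS n, zIter T.toEquiv m ⁻¹' A)

/-- The upper unitriangular matrix `M(a)` with entries `(M(a))_{i, i+k} = a i k`
(1-based indexing). -/
def Mmat (d : ℕ) (a : ℕ → ℕ → ℝ) : Matrix (Fin (d + 1)) (Fin (d + 1)) ℝ :=
  fun r c =>
    if (r : ℕ) = (c : ℕ) then 1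
    else if (r : ℕ) < (c : ℕ) then a ((r : ℕ) + 1) ((c : ℕ) - (r : ℕ)) else 0

/-- `P_ℓ(a; i, k) = ∑ a_i^{s₁} a_{i+s₁}^{s₂} ⋯`, sum over `(s₁,…,s_ℓ) ∈ {1,…,k}^ℓ`
with `s₁ + ⋯ + s_ℓ = k`. -/
def Ppoly (a : ℕ → ℕ → ℝ) (i k ℓ : ℕ) : ℝ :=
  ∑ s ∈ Finset.univ.filter (fun s : Fin ℓ → Fin k => (∑ t, ((s t : ℕ) + 1)) = k),
    ∏ t : Fin ℓ,
      a (i + ∑ u ∈ Finset.univ.filter (fun u : Fin ℓ => u < t), ((s u : ℕ) + 1))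
        ((s t : ℕ) + 1)

/-- The upper unitriangular matrix with superdiagonal `α₁, …, α_d` (1-based). -/
def Amat (d : ℕ) (α : ℕ → ℝ) : Matrix (Fin (d + 1)) (Fin (d + 1)) ℝ :=
  fun r c =>
    if (r : ℕ) = (c : ℕ) then 1
    else if (c : ℕ) = (r : ℕ) + 1 then α ((r : ℕ) + 1) else 0

end

section

open scoped Classical
open MeasureTheory Filter Topology

namespace DHJ

noncomputable def av {X : Type} [Finite X] (f : X → ℝ) : ℝ :=
  letI := Fintype.ofFinite X; (∑ x, f x) / (Nat.card X : ℝ)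

lemma av_eq {X : Type} [hX : Fintype X] (f : X → ℝ) : av f = (∑ x, f x) / (Nat.card X : ℝ) := by
  unfold av
  rw [Subsingleton.elim (Fintype.ofFinite X) hX]

noncomputable def ind {X : Type} (A : Set X) (x : X) : ℝ := if x ∈ A then 1 else 0

lemma ind_nonneg {X : Type} (A : Set X) (x : X) : 0 ≤ ind A x := by unfold ind; split_ifs <;> norm_num
lemma ind_le_one {X : Type} (A : Set X) (x : X) : ind A x ≤ 1 := by unfold ind; split_ifs <;> norm_num

section av
variable {X Y : Type} [Finite X] [Finite Y]

lemma av_const [Nonempty X] (c : ℝ) : av (fun _ : X => c) = c := by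
  letI := Fintype.ofFinite X
  rw [av_eq]
  have : (Nat.card X : ℝ) ≠ 0 := by exact_mod_cast Nat.card_pos.ne'
  simp [Finset.sum_const]

lemma av_mono {f g : X → ℝ} (h : ∀ x, f x ≤ g x) : av f ≤ av g := by
  letI := Fintype.ofFinite X
  rw [av_eq, av_eq]
  exact div_le_div_of_nonneg_right (Finset.sum_le_sum fun x _ => h x) (by positivity)

lemma av_add (f g : X → ℝ) : av (fun x => f x + g x) = av f + av g := by
  letI := Fintype.ofFinite X
  rw [av_eq, av_eq, av_eq, Finset.sum_add_distrib, add_div]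

lemma av_mul (c : ℝ) (f : X → ℝ) : av (fun x => c * f x) = c * av f := by
  letI := Fintype.ofFinite X
  rw [av_eq, av_eq, ← Finset.mul_sum, mul_div_assoc]

lemma av_sub (f g : X → ℝ) : av (fun x => f x - g x) = av f - av g := by
  letI := Fintype.ofFinite X
  rw [av_eq, av_eq, av_eq, Finset.sum_sub_distrib, sub_div]

lemma av_finsum {ι : Type} (s : Finset ι) (f : ι → X → ℝ) :
    av (fun x => ∑ i ∈ s, f i x) = ∑ i ∈ s, av (f i) := by
  letI := Fintype.ofFinite X
  simp_rw [av_eq]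
  rw [Finset.sum_comm, Finset.sum_div]

lemma av_prod (f : X × Y → ℝ) : av f = av fun x => av fun y => f (x, y) := by
  letI := Fintype.ofFinite X
  letI := Fintype.ofFinite Y
  simp_rw [av_eq]
  rw [Fintype.sum_prod_type, ← Finset.sum_div, Nat.card_prod]
  push_cast
  rw [div_div, mul_comm (Nat.card Y : ℝ)]

lemma av_equiv (e : X ≃ Y) (f : Y → ℝ) : av (fun x => f (e x)) = av f := by
  letI := Fintype.ofFinite X
  letI := Fintype.ofFinite Y
  simp_rw [av_eq]
  rw [Nat.card_congr e, Equiv.sum_comp e]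

lemma av_comm (f : X → Y → ℝ) : av (fun x => av fun y => f x y) = av fun y => av fun x => f x y := by
  rw [← av_prod (fun p : X × Y => f p.1 p.2), ← av_prod (fun p : Y × X => f p.2 p.1),
    ← av_equiv (Equiv.prodComm X Y)]
  rfl

lemma exists_ge_av [Nonempty X] {f : X → ℝ} {c : ℝ} (h : c ≤ av f) : ∃ x, c ≤ f x := by
  by_contra! H
  letI := Fintype.ofFinite X
  have h2 : av f < c := by
    rw [av_eq, div_lt_iff₀ (by exact_mod_cast Nat.card_pos)]
    calc ∑ x, f x < ∑ x : X, c := Finset.sum_lt_sum_of_nonempty Finset.univ_nonempty fun x _ => H x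
      _ = _ := by simp [mul_comm]
  linarith

lemma av_nonneg {f : X → ℝ} (h : ∀ x, 0 ≤ f x) : 0 ≤ av f := by
  letI := Fintype.ofFinite X
  rw [av_eq]
  exact div_nonneg (Finset.sum_nonneg fun x _ => h x) (by positivity)

lemma av_le_of_le [Nonempty X] {f : X → ℝ} {c : ℝ} (h : ∀ x, f x ≤ c) : av f ≤ c :=
  (av_mono h).trans (av_const c).le

lemma le_of_av_ge {h : X → ℝ} {M t : ℝ} (h1 : ∀ x, h x ≤ M) (h2 : M - t ≤ av h) (x : X) :
    M - Nat.card X * t ≤ h x := by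
  letI := Fintype.ofFinite X
  haveI : Nonempty X := ⟨x⟩
  have hp : (0:ℝ) < Nat.card X := by exact_mod_cast Nat.card_pos
  rw [av_eq, le_div_iff₀ hp] at h2
  have h3 : ∑ y, (M - h y) = Nat.card X * M - ∑ y, h y := by simp [Finset.sum_sub_distrib]
  have h4 : M - h x ≤ ∑ y, (M - h y) :=
    Finset.single_le_sum (f := fun y => M - h y) (fun y _ => sub_nonneg.2 (h1 y)) (Finset.mem_univ x)
  nlinarith

end av
end DHJ


end

section

open scoped Classical
open MeasureTheory Filter Topology

namespace DHJ

def sub {ι β κ : Type} (φ : ι → β ⊕ κ) (v : κ → β) : ι → β := fun i => Sum.elim id v (φ i)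
def Proper {ι β κ : Type} (φ : ι → β ⊕ κ) : Prop := ∀ e, ∃ i, φ i = Sum.inr e
def comp {ι β κ κ' : Type} (φ : ι → β ⊕ κ) (ψ : κ → β ⊕ κ') : ι → β ⊕ κ' :=
  fun i => Sum.elim Sum.inl ψ (φ i)

lemma sub_comp {ι β κ κ' : Type} (φ : ι → β ⊕ κ) (ψ : κ → β ⊕ κ') (v : κ' → β) :
    sub (comp φ ψ) v = sub φ (sub ψ v) := by
  funext i
  unfold sub comp
  cases φ i <;> simp

lemma Proper.comp {ι β κ κ' : Type} {φ : ι → β ⊕ κ} {ψ : κ → β ⊕ κ'} (h : Proper φ)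
    (h' : Proper ψ) : Proper (comp φ ψ) := by
  intro e
  obtain ⟨k, hk⟩ := h' e
  obtain ⟨i, hi⟩ := h k
  exact ⟨i, by simp [DHJ.comp, hi, hk]⟩

def HasSub {ι β : Type} (κ : Type) (A : Set (ι → β)) : Prop :=
  ∃ φ : ι → β ⊕ κ, Proper φ ∧ ∀ v, sub φ v ∈ A

lemma HasSub.pull {ι κ' β : Type} {κ : Type} {A : Set (ι → β)} {φ : ι → β ⊕ κ'} (hφ : Proper φ)
    (h : HasSub κ {z | sub φ z ∈ A}) : HasSub κ A := by
  obtain ⟨ψ, h1, h2⟩ := h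
  exact ⟨comp φ ψ, hφ.comp h1, fun v => by rw [sub_comp]; exact h2 v⟩

lemma HasSub.mono {ι β : Type} {κ : Type} {A B : Set (ι → β)} (hAB : A ⊆ B) (h : HasSub κ A) :
    HasSub κ B := by
  obtain ⟨ψ, h1, h2⟩ := h
  exact ⟨ψ, h1, fun v => hAB (h2 v)⟩

def HJ (β κ : Type) [Finite β] (δ : ℝ) (ι : Type) [Finite ι] : Prop :=
  ∀ A : Set (ι → β), δ ≤ av (ind A) → HasSub κ A

def DHJ (β : Type) [Finite β] : Prop := ∀ δ : ℝ, 0 < δ → ∃ n : ℕ, HJ β Unit δ (Fin n)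

lemma av_sumArrow {β ι ι' : Type} [Finite β] [Finite ι] [Finite ι'] (f : (ι ⊕ ι' → β) → ℝ) :
    av f = av fun x : ι → β => av fun y : ι' → β => f (Sum.elim x y) := by
  rw [← av_prod (fun p : (ι → β) × (ι' → β) => f (Sum.elim p.1 p.2)),
    ← av_equiv (Equiv.sumArrowEquivProdArrow ι ι' β)]
  congr 1
  funext x
  congr 1
  funext i
  cases i <;> rfl

section
variable {β κ : Type} [Finite β] {δ : ℝ} {ι ι' : Type} [Finite ι] [Finite ι']

lemma HJ.equiv (e : ι ≃ ι') (h : HJ β κ δ ι) : HJ β κ δ ι' := by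
  intro A hA
  have : HasSub κ {z : ι → β | sub (fun i : ι' => (Sum.inr (e.symm i) : β ⊕ ι)) z ∈ A} := by
    apply h
    refine hA.trans (le_of_eq ?_)
    rw [← av_equiv (Equiv.arrowCongr e (Equiv.refl β))]
    rfl
  exact this.pull fun i => ⟨e i, by simp⟩

lemma HJ.sum [Nonempty β] (h : HJ β κ δ ι) : HJ β κ δ (ι ⊕ ι') := by
  intro A hA
  rw [av_sumArrow, av_comm] at hA
  obtain ⟨y, hy⟩ := exists_ge_av hA
  have := h {z : ι → β | sub (fun i : ι ⊕ ι' => (Sum.elim Sum.inr (fun j => Sum.inl (y j)) i : β ⊕ ι)) z ∈ A} (by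
    refine hy.trans (le_of_eq ?_)
    congr 1
    funext x
    unfold ind
    congr 1
    simp only [Set.mem_setOf_eq, eq_iff_iff]
    have : (Sum.elim x y) = sub (fun i : ι ⊕ ι' => (Sum.elim Sum.inr (fun j => Sum.inl (y j)) i : β ⊕ ι)) x := by
      funext i
      cases i <;> rfl
    rw [this])
  exact this.pull fun i => ⟨Sum.inl i, by simp⟩

lemma HJ.card [Nonempty β] {n : ℕ} (h : HJ β κ δ (Fin n)) (hn : n ≤ Nat.card ι) : HJ β κ δ ι := by
  obtain ⟨m, hm⟩ := Nat.exists_eq_add_of_le hn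
  have e : (Fin n ⊕ Fin m) ≃ ι := finSumFinEquiv.trans
    ((finCongr hm.symm).trans (Finite.equivFin ι).symm)
  exact HJ.equiv e h.sum
end

lemma markov {Y : Type} [Finite Y] [Nonempty Y] {f : Y → ℝ} {δ : ℝ} (hf : ∀ y, f y ≤ 1) (hδ : 0 ≤ δ)
    (h : δ ≤ av f) : δ / 2 ≤ av (ind {y | δ / 2 ≤ f y}) := by
  have : av f ≤ av (fun y => ind {y | δ / 2 ≤ f y} y + δ / 2) := by
    apply av_mono
    intro y
    unfold ind
    split_ifs with h1
    · linarith [hf y]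
    · simp only [Set.mem_setOf_eq, not_le] at h1
      linarith
  rw [av_add, av_const] at this
  linarith

lemma pigeon {Y L : Type} [Finite Y] [Finite L] [Nonempty L] (G : Set Y) (P : Y → L → Prop)
    (h : ∀ y ∈ G, ∃ l, P y l) : ∃ l, av (ind G) / Nat.card L ≤ av (ind {y | P y l}) := by
  letI := Fintype.ofFinite L
  have h1 : av (ind G) ≤ ∑ l : L, av (ind {y | P y l}) := by
    rw [← av_finsum]
    apply av_mono
    intro y
    unfold ind
    split_ifs with hy
    · obtain ⟨l, hl⟩ := h y hy
      refine le_trans ?_ (Finset.single_le_sum (f := fun l => if y ∈ {y | P y l} then (1:ℝ) else 0)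
        (fun i _ => by positivity) (Finset.mem_univ l))
      simp [hl]
    · positivity
  by_contra! H
  have : ∑ l : L, av (ind {y | P y l}) < ∑ l : L, av (ind G) / Nat.card L :=
    Finset.sum_lt_sum_of_nonempty Finset.univ_nonempty fun l _ => H l
  have hp : (Nat.card L : ℝ) ≠ 0 := by exact_mod_cast Nat.card_pos.ne'
  rw [Finset.sum_const, Finset.card_univ, ← Nat.card_eq_fintype_card, nsmul_eq_mul] at this
  field_simp at this
  linarith

lemma MDHJ {β : Type} [Finite β] [Nonempty β] (hβ : DHJ β) (κ : Type) [Finite κ] :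
    ∀ δ : ℝ, 0 < δ → ∃ n : ℕ, HJ β κ δ (Fin n) := by
  induction κ using Finite.induction_empty_option with
  | of_equiv e ih =>
    rename_i κ κ'
    intro δ hδ
    obtain ⟨n, hn⟩ := ih δ hδ
    refine ⟨n, fun A hA => ?_⟩
    obtain ⟨φ, h1, h2⟩ := hn A hA
    refine ⟨comp φ (fun e' => Sum.inr (e e')), h1.comp (fun i => ⟨e.symm i, by simp⟩), fun v => ?_⟩
    rw [sub_comp]
    exact h2 _
  | h_empty =>
    intro δ hδ
    refine ⟨0, fun A hA => ?_⟩
    obtain ⟨x, hx⟩ := exists_ge_av hA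
    have hxA : x ∈ A := by
      by_contra h
      simp [ind, h] at hx
      linarith
    refine ⟨fun i => Sum.inl (x i), fun e => e.elim, fun v => ?_⟩
    exact hxA
  | h_option ih =>
    rename_i κ hκ
    intro δ hδ
    haveI : Finite κ := Finite.of_fintype κ
    obtain ⟨n1, hn1⟩ := hβ (δ / 2) (by positivity)
    have hnl : 0 < (Nat.card (Fin n1 → β ⊕ Unit) : ℝ) := by exact_mod_cast Nat.card_pos
    obtain ⟨m, hm⟩ := ih (δ / 2 / Nat.card (Fin n1 → β ⊕ Unit)) (by positivity)
    refine ⟨m + n1, HJ.equiv (finSumFinEquiv : Fin m ⊕ Fin n1 ≃ _) ?_⟩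
    intro A hA
    rw [av_sumArrow] at hA
    have h1 := markov (fun y => av_le_of_le fun x => ind_le_one A _) hδ.le hA
    obtain ⟨φ, hφ⟩ := pigeon (L := Fin n1 → β ⊕ Unit)
      {y | δ / 2 ≤ av fun x : Fin n1 → β => ind A (Sum.elim y x)}
      (fun y φ => Proper φ ∧ ∀ v, Sum.elim y (sub φ v) ∈ A) (by
        intro y hy
        obtain ⟨φ, h1, h2⟩ := hn1 {x | Sum.elim y x ∈ A} hy
        exact ⟨φ, h1, h2⟩)
    obtain ⟨ψ, h3, h4⟩ := hm _ ((div_le_div_of_nonneg_right h1 hnl.le).trans hφ)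
    refine ⟨Sum.elim (fun i => Sum.map id some (ψ i)) (fun i => Sum.map id (fun _ => none) (φ i)), ?_, ?_⟩
    · intro e
      cases e with
      | none =>
        obtain ⟨i, hi⟩ := (h4 (fun _ => Classical.arbitrary β)).1 ()
        exact ⟨Sum.inr i, by simp [hi]⟩
      | some e =>
        obtain ⟨i, hi⟩ := h3 e
        exact ⟨Sum.inl i, by simp [hi]⟩
    · intro v
      have := (h4 (fun e => v (some e))).2 (fun _ => v none)
      convert this using 1
      funext i
      rcases i with i | i
      · simp only [sub, Sum.elim_inl]
        cases ψ i <;> simp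
      · simp only [sub, Sum.elim_inr]
        cases φ i <;> simp
end DHJ


end

section

open scoped Classical
open MeasureTheory Filter Topology

namespace DHJ

def Ins {ι α : Type} (r : α) (D : Set (ι → Option α)) : Prop :=
  ∀ x y, (∀ i, (x i).getD r = (y i).getD r) → x ∈ D → y ∈ D

lemma av_pi {α : Type} [Finite α] (L : ℕ) (h : α → ℝ) :
    av (fun x : Fin L → α => ∏ i, h (x i)) = (av h) ^ L := by
  letI := Fintype.ofFinite α
  rw [av_eq, av_eq, div_pow, Fintype.sum_pow]
  simp

/-- resampling the non-`none` letters -/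
def rs {α : Type} : Option α × α ≃ Option α × α where
  toFun p := match p with
    | (none, u) => (none, u)
    | (some a, u) => (some u, a)
  invFun p := match p with
    | (none, u) => (none, u)
    | (some a, u) => (some u, a)
  left_inv p := by rcases p with ⟨_ | a, u⟩ <;> rfl
  right_inv p := by rcases p with ⟨_ | a, u⟩ <;> rfl

lemma av_rs {α : Type} [Finite α] [Nonempty α] (L : ℕ) (F : (Fin L → Option α) → ℝ) :
    av F = av fun x : Fin L → Option α => av fun u : Fin L → α =>
      F (fun i => (rs (x i, u i)).1) := by
  have e : ((Fin L → Option α) × (Fin L → α)) ≃ ((Fin L → Option α) × (Fin L → α)) :=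
    (Equiv.arrowProdEquivProdArrow (Fin L) (fun _ => Option α) (fun _ => α)).symm.trans
      ((Equiv.piCongrRight fun _ => rs).trans
        (Equiv.arrowProdEquivProdArrow (Fin L) (fun _ => Option α) (fun _ => α)))
  rw [← av_prod (fun p : (Fin L → Option α) × (Fin L → α) => F (fun i => (rs (p.1 i, p.2 i)).1))]
  have h1 : av F = av (fun p : (Fin L → Option α) × (Fin L → α) => F p.1) := by
    rw [av_prod]
    congr 1
    funext x
    exact (av_const _).symm
  rw [h1, ← av_equiv ((Equiv.arrowProdEquivProdArrow (Fin L) (fun _ => Option α) (fun _ => α)).symm.trans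
      ((Equiv.piCongrRight fun _ => rs).trans
        (Equiv.arrowProdEquivProdArrow (Fin L) (fun _ => Option α) (fun _ => α))))]
  rfl

lemma av_restrict {α : Type} [Finite α] [Nonempty α] {I : Type} [Finite I] (p : I → Prop)
    (g : ({i // p i} → α) → ℝ) :
    av (fun u : I → α => g (fun i => u i.1)) = av g := by
  have h1 : av g = av (fun q : ({i // p i} → α) × ({i // ¬ p i} → α) => g q.1) := by
    rw [av_prod]
    congr 1
    funext x
    exact (av_const _).symm
  rw [h1, ← av_equiv (Equiv.piEquivPiSubtypeProd p (fun _ => α))]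
  rfl

lemma P0 {α : Type} [Finite α] [Nonempty α] (hα : DHJ α) (κ : Type) [Finite κ] (η : ℝ) (hη : 0 < η) :
    ∃ L : ℕ, ∀ r : α, ∀ E : Set (Fin L → Option α), Ins r E → η ≤ av (ind E) → HasSub κ E := by
  obtain ⟨m, hm⟩ := MDHJ hα κ (η / 2) (by positivity)
  set h : Option α → ℝ := fun b => if b = none then 1 else 1/2 with hh
  have hav : 0 ≤ av h ∧ av h < 1 := by
    refine ⟨av_nonneg fun b => by simp only [hh]; split_ifs <;> norm_num, ?_⟩
    by_contra! H
    have h1 := le_of_av_ge (h := h) (M := 1) (t := 0)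
      (fun b => by simp only [hh]; split_ifs <;> norm_num) (by linarith) (some (Classical.arbitrary α))
    simp only [hh, reduceCtorEq, if_false] at h1
    norm_num at h1
  obtain ⟨L, hL⟩ : ∃ L : ℕ, 2 ^ m * (av h) ^ L < η / 2 := by
    obtain ⟨L, hL⟩ := exists_pow_lt_of_lt_one (show 0 < η / 2 / 2 ^ m by positivity) hav.2
    refine ⟨L, ?_⟩
    rwa [lt_div_iff₀ (by positivity), mul_comm] at hL
  refine ⟨L, fun r E hE hd => ?_⟩
  by_contra hno
  rw [av_rs] at hd
  have key : ∀ x : Fin L → Option α, (av fun u : Fin L → α => ind E (fun i => (rs (x i, u i)).1)) ≤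
      η / 2 + 2 ^ m * ∏ i, h (x i) := by
    intro x
    have hpos : (0:ℝ) ≤ ∏ i, h (x i) := Finset.prod_nonneg fun i _ => by
      simp only [hh]; split_ifs <;> norm_num
    by_cases hc : m ≤ Nat.card {i // x i ≠ none}
    · have : HJ α κ (η / 2) {i // x i ≠ none} := hm.card hc
      by_contra! H
      have hEx : (fun u : Fin L → α => ind E (fun i => (rs (x i, u i)).1)) =
          (fun u : Fin L → α => ind {w : {i // x i ≠ none} → α |
            (fun i => if h : x i ≠ none then some (w ⟨i, h⟩) else none) ∈ E} (fun i => u i.1)) := by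
        funext u
        unfold ind
        congr 1
        simp only [Set.mem_setOf_eq, eq_iff_iff]
        have : (fun i => (rs (x i, u i)).1) =
          (fun i => if h : x i ≠ none then some (u i) else none) := by
          funext i
          rcases hxi : x i with _ | a <;> simp [rs]
        rw [this]
      rw [hEx, av_restrict (fun i => x i ≠ none) (ind {w : {i // x i ≠ none} → α |
            (fun i => if h : x i ≠ none then some (w ⟨i, h⟩) else none) ∈ E})] at H
      obtain ⟨φ, hφ, hφ2⟩ := this {w : {i // x i ≠ none} → α |
            (fun i => if h : x i ≠ none then some (w ⟨i, h⟩) else none) ∈ E} (by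
        have : (0:ℝ) ≤ 2 ^ m * ∏ i, h (x i) := by positivity
        linarith)
      apply hno
      refine ⟨fun i => if hi : x i ≠ none then Sum.map some id (φ ⟨i, hi⟩) else Sum.inl none, ?_, ?_⟩
      · intro e
        obtain ⟨⟨i, hi⟩, hi2⟩ := hφ e
        exact ⟨i, by simp only [dif_pos hi, hi2]; rfl⟩
      · intro v
        refine hE _ _ ?_ (hφ2 (fun e => (v e).getD r))
        intro i
        by_cases hi : x i ≠ none
        · simp only [sub, dif_pos hi]
          cases φ ⟨i, hi⟩ <;> simp
        · simp only [sub, dif_neg hi]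
          simp
    · have h1 : (1:ℝ) ≤ 2 ^ m * ∏ i, h (x i) := by
        have h2 : ∏ i, h (x i) = (1/2) ^ (Nat.card {i // x i ≠ none}) := by
          simp only [hh]
          rw [Finset.prod_ite]
          simp only [Finset.prod_const_one, one_mul, Finset.prod_const, Nat.card_eq_fintype_card,
            Fintype.card_subtype]
        rw [h2]
        push Not at hc
        have h3 : (1/2:ℝ) ^ m ≤ (1/2) ^ (Nat.card {i // x i ≠ none}) :=
          pow_le_pow_of_le_one (by norm_num) (by norm_num) hc.le
        calc (1:ℝ) = 2 ^ m * (1/2) ^ m := by rw [← mul_pow]; norm_num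
          _ ≤ _ := by gcongr
      have h2 : (av fun u : Fin L → α => ind E (fun i => (rs (x i, u i)).1)) ≤ 1 :=
        av_le_of_le fun u => ind_le_one _ _
      linarith
  have h2 := hd.trans (av_mono key)
  rw [av_add, av_const, av_mul, av_pi] at h2
  linarith

end DHJ


end

section

open scoped Classical
open MeasureTheory Filter Topology

namespace DHJ

lemma Proper.inj {ι β κ : Type} {φ : ι → β ⊕ κ} (h : Proper φ) : Function.Injective (sub φ) := by
  intro v w hvw
  funext e
  obtain ⟨i, hi⟩ := h e
  have := congrFun hvw i
  simpa [sub, hi] using this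

lemma av_range {ι β κ : Type} [Finite ι] [Finite β] [Finite κ] [Nonempty β] {φ : ι → β ⊕ κ}
    (h : Proper φ) (g : (ι → β) → ℝ) :
    av (fun x => ind (Set.range (sub φ)) x * g x) =
      (Nat.card (κ → β) / Nat.card (ι → β) : ℝ) * av (fun v => g (sub φ v)) := by
  letI := Fintype.ofFinite (ι → β)
  letI := Fintype.ofFinite (κ → β)
  have h1 : (0:ℝ) < Nat.card (κ → β) := by exact_mod_cast Nat.card_pos
  rw [av_eq, av_eq]
  have : ∑ x, ind (Set.range (sub φ)) x * g x = ∑ v, g (sub φ v) := by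
    rw [← Finset.sum_image (f := g) (g := sub φ) (s := Finset.univ) (fun a _ b _ hab => h.inj hab)]
    rw [← Finset.sum_filter_add_sum_filter_not Finset.univ (fun x => x ∈ Set.range (sub φ))]
    rw [Finset.sum_eq_zero (s := Finset.univ.filter (fun x => ¬ x ∈ Set.range (sub φ)))]
    · rw [add_zero]
      apply Finset.sum_congr
      · ext x; simp
      · intro x hx
        simp at hx
        simp [ind, hx]
    · intro x hx
      simp at hx
      simp [ind, hx]
  rw [this]
  field_simp

noncomputable def sel {ι β : Type} (κ : Type) (E : Set (ι → β)) : Set (ι → β) :=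
  if h : HasSub κ E then Set.range (sub h.choose) else ∅

lemma sel_sub {ι β κ : Type} (E : Set (ι → β)) : sel κ E ⊆ E := by
  unfold sel
  split_ifs with h
  · rintro _ ⟨v, rfl⟩
    exact h.choose_spec.2 v
  · exact Set.empty_subset _

lemma Ins.eqv {ι α : Type} {r : α} {D : Set (ι → Option α)} (h : Ins r D) {x y : ι → Option α}
    (hxy : ∀ i, (x i).getD r = (y i).getD r) : x ∈ D ↔ y ∈ D :=
  ⟨h x y hxy, h y x fun i => (hxy i).symm⟩

lemma P1_claim {α : Type} [Finite α] [Nonempty α] (κ : Type) [Finite κ] (η : ℝ) (hη : 0 < η)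
    (L : ℕ) (c : ℝ) (hc : c = (Nat.card (κ → Option α) / Nat.card (Fin L → Option α) : ℝ))
    (hL : ∀ r : α, ∀ E : Set (Fin L → Option α), Ins r E → η / 2 ≤ av (ind E) → HasSub κ E) (s : ℕ) :
    ∃ (ι : Type) (_ : Finite ι), ∀ r : α, ∀ (Z : Type) [Finite Z] [Nonempty Z]
      (D : Z → Set (ι → Option α)) (f : Z → (ι → Option α) → ℝ), (∀ z, Ins r (D z)) →
      (∀ z x, f z x ≤ 1) →
      (∀ z (φ : ι → Option α ⊕ κ), Proper φ → av (fun v => f z (sub φ v)) ≤ 0) →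
      av (fun z => av fun x => ind (D z) x * f z x) ≤
        max η (av (fun z => av fun x => ind (D z) x) - s * (c * (η / 2))) := by
  have hc0 : 0 ≤ c := by rw [hc]; positivity
  induction s with
  | zero =>
    refine ⟨Empty, inferInstance, fun r Z _ _ D f hD hf hφ => le_max_of_le_right ?_⟩
    simp only [Nat.cast_zero, zero_mul, sub_zero]
    refine av_mono fun z => av_mono fun x => ?_
    have := ind_nonneg (D z) x
    nlinarith [hf z x]
  | succ s ih =>
    obtain ⟨ι, hι, ih⟩ := ih
    refine ⟨Fin L ⊕ ι, inferInstance, fun r Z _ _ D f hD hf hφ => ?_⟩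
    by_cases ha : (av fun z => av fun x => ind (D z) x) ≤ η
    · refine le_max_of_le_left (le_trans (av_mono fun z => av_mono fun x => ?_) ha)
      have := ind_nonneg (D z) x
      nlinarith [hf z x]
    push Not at ha
    set E : Z → (ι → Option α) → Set (Fin L → Option α) := fun z x' => {x1 | Sum.elim x1 x' ∈ D z} with hE
    have hEI : ∀ z x', Ins r (E z x') := by
      intro z x' x y hxy hx
      refine hD z _ _ ?_ hx
      rintro (i | i)
      · exact hxy i
      · rfl
    have hsel1 : ∀ z x', c * (av (ind (E z x')) - η / 2) ≤ av (ind (sel κ (E z x'))) := by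
      intro z x'
      by_cases h : HasSub κ (E z x')
      · have h1 : av (ind (sel κ (E z x'))) = c := by
          have := av_range h.choose_spec.1 (fun _ => 1)
          simp only [mul_one, av_const, ← hc] at this
          rw [← this, sel, dif_pos h]
        rw [h1]
        have : av (ind (E z x')) ≤ 1 := av_le_of_le (ind_le_one _)
        nlinarith
      · have h1 : av (ind (E z x')) < η / 2 := by
          by_contra! H
          exact h (hL r _ (hEI z x') H)
        have : 0 ≤ av (ind (sel κ (E z x'))) := av_nonneg (ind_nonneg _)
        nlinarith
    have hsel2 : ∀ z x', av (fun x1 => ind (sel κ (E z x')) x1 * f z (Sum.elim x1 x')) ≤ 0 := by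
      intro z x'
      by_cases h : HasSub κ (E z x')
      · rw [sel, dif_pos h, av_range h.choose_spec.1 (fun x1 => f z (Sum.elim x1 x'))]
        refine mul_nonpos_of_nonneg_of_nonpos (by positivity) ?_
        refine le_trans (le_of_eq ?_) (hφ z (Sum.elim h.choose (fun i => Sum.inl (x' i))) ?_)
        · congr 1
          funext v
          congr 1
          funext i
          cases i <;> rfl
        · intro e
          obtain ⟨i, hi⟩ := h.choose_spec.1 e
          exact ⟨Sum.inl i, hi⟩
      · rw [sel, dif_neg h]
        simp [ind, av_const]
    set D' : Z × (Fin L → Option α) → Set (ι → Option α) :=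
      fun p => {x' | Sum.elim p.2 x' ∈ D p.1 ∧ p.2 ∉ sel κ (E p.1 x')} with hD'
    have hsplit : ∀ z x1 x', ind (D z) (Sum.elim x1 x') =
        ind (sel κ (E z x')) x1 + ind (D' (z, x1)) x' := by
      intro z x1 x'
      have h1 : x1 ∈ sel κ (E z x') → Sum.elim x1 x' ∈ D z := fun h => sel_sub (E z x') h
      simp only [ind, hD', Set.mem_setOf_eq]
      by_cases h2 : x1 ∈ sel κ (E z x')
      · simp [h2, h1 h2]
      · simp [h2]
    have hI' : ∀ p, Ins r (D' p) := by
      rintro ⟨z, x1⟩ x y hxy ⟨hx1, hx2⟩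
      have hEE : E z x = E z y := by
        ext w
        refine (hD z).eqv ?_
        rintro (i | i)
        · rfl
        · exact hxy i
      refine ⟨?_, ?_⟩
      · have : x1 ∈ E z x := hx1
        rw [hEE] at this
        exact this
      · simp only at hx2 ⊢
        rwa [← hEE]
    have hmain := ih r (Z × (Fin L → Option α)) D' (fun p x' => f p.1 (Sum.elim p.2 x')) hI'
      (fun p x' => hf _ _) (by
        intro p φ hp
        refine le_trans (le_of_eq ?_) (hφ p.1 (Sum.elim (fun i => Sum.inl (p.2 i)) φ) ?_)
        · congr 1
          funext v
          congr 1
          funext i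
          cases i <;> rfl
        · intro e
          obtain ⟨i, hi⟩ := hp e
          exact ⟨Sum.inr i, hi⟩)
    rw [av_prod, av_prod] at hmain
    have e1 : (av fun z => av fun x => ind (D z) x * f z x) =
        (av fun z => av fun x' => av fun x1 => ind (sel κ (E z x')) x1 * f z (Sum.elim x1 x')) +
        av fun z => av fun x1 => av fun x' => ind (D' (z, x1)) x' * f z (Sum.elim x1 x') := by
      rw [← av_add]
      congr 1
      funext z
      rw [av_comm (fun x1 x' => ind (D' (z, x1)) x' * f z (Sum.elim x1 x')), ← av_add, av_sumArrow, av_comm]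
      congr 1
      funext x'
      rw [← av_add]
      congr 1
      funext x1
      rw [hsplit]
      ring
    have e2 : (av fun z => av fun x => ind (D z) x) =
        (av fun z => av fun x' => av (ind (sel κ (E z x')))) +
        av fun z => av fun x1 => av fun x' => ind (D' (z, x1)) x' := by
      rw [← av_add]
      congr 1
      funext z
      rw [av_comm (fun x1 x' => ind (D' (z, x1)) x'), ← av_add, av_sumArrow, av_comm]
      congr 1
      funext x'
      rw [← av_add]
      congr 1
      funext x1
      rw [hsplit]
    have e3 : (av fun z => av fun x' => av fun x1 => ind (sel κ (E z x')) x1 * f z (Sum.elim x1 x')) ≤ 0 :=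
      av_le_of_le fun z => av_le_of_le fun x' => hsel2 z x'
    have e4 : c * ((av fun z => av fun x => ind (D z) x) - η / 2) ≤
        (av fun z => av fun x' => av (ind (sel κ (E z x')))) := by
      refine le_trans (le_of_eq ?_) (av_mono fun z => av_mono fun x' => hsel1 z x')
      simp_rw [av_mul, av_sub, av_const]
      congr 3
      funext z
      rw [av_sumArrow, av_comm]
      rfl
    rw [e1]
    refine le_trans (add_le_add e3 hmain) ?_
    rw [zero_add]
    refine max_le_max le_rfl ?_
    push_cast
    nlinarith

lemma P1 {α : Type} [Finite α] [Nonempty α] (hα : DHJ α) (κ : Type) [Finite κ] (η : ℝ) (hη : 0 < η) :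
    ∃ (ι : Type) (_ : Finite ι), ∀ r : α, ∀ (D : Set (ι → Option α)) (f : (ι → Option α) → ℝ), Ins r D →
      (∀ x, f x ≤ 1) → (∀ (φ : ι → Option α ⊕ κ), Proper φ → av (fun v => f (sub φ v)) ≤ 0) →
      av (fun x => ind D x * f x) ≤ η := by
  obtain ⟨L, hL⟩ := P0 hα κ (η / 2) (by positivity)
  have hc : (0:ℝ) < (Nat.card (κ → Option α) / Nat.card (Fin L → Option α) : ℝ) := by
    have h1 : (0:ℝ) < Nat.card (κ → Option α) := by exact_mod_cast Nat.card_pos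
    have h2 : (0:ℝ) < Nat.card (Fin L → Option α) := by exact_mod_cast Nat.card_pos
    positivity
  obtain ⟨s, hs⟩ := exists_nat_ge (1 / ((Nat.card (κ → Option α) / Nat.card (Fin L → Option α) : ℝ) * (η / 2)))
  rw [div_le_iff₀ (by positivity)] at hs
  obtain ⟨ι, hι, h⟩ := P1_claim κ η hη L _ rfl hL s
  refine ⟨ι, hι, fun r D f hD hf hφ => ?_⟩
  have h1 := h r Unit (fun _ => D) (fun _ => f) (fun _ => hD) (fun _ => hf) (fun _ => hφ)
  rw [av_const, av_const] at h1
  refine h1.trans (max_le le_rfl ?_)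
  have : av (ind D) ≤ 1 := av_le_of_le (ind_le_one _)
  have e : (av fun x => ind D x) = av (ind D) := rfl
  rw [e]
  linarith

lemma IS {α : Type} [Finite α] [Nonempty α] (hα : DHJ α) (n0 : ℕ) (R : Finset α) :
    ∀ η : ℝ, 0 < η → ∃ (ι : Type) (_ : Finite ι), ∀ (D : α → Set (ι → Option α))
      (f : (ι → Option α) → ℝ), (∀ r, Ins r (D r)) → (∀ x, f x ≤ 1) →
      (∀ (φ : ι → Option α ⊕ Fin n0), Proper φ → av (fun v => f (sub φ v)) ≤ 0) →
      av (fun x => ind {x | ∀ r ∈ R, x ∈ D r} x * f x) ≤ η := by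
  induction R using Finset.induction_on with
  | empty =>
    intro η hη
    refine ⟨Fin n0, inferInstance, fun D f hD hf hφ => ?_⟩
    have := hφ (fun i => Sum.inr i) (fun e => ⟨e, rfl⟩)
    simp only [Finset.notMem_empty, false_imp_iff, implies_true, Set.setOf_true, ind, Set.mem_univ, if_true, one_mul]
    exact le_trans this hη.le
  | insert r0 R hr0 ih =>
    intro η hη
    obtain ⟨κ, hκ, ih⟩ := ih (η / 2) (by positivity)
    obtain ⟨ι, hι, h⟩ := P1 hα κ (η / 2) (by positivity)
    refine ⟨ι, hι, fun D f hD hf hφ => ?_⟩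
    have h1 := h r0 (D r0) (fun x => ind {x | ∀ r ∈ R, x ∈ D r} x * f x - η / 2) (hD r0) (by
      intro x
      have := ind_nonneg {x | ∀ r ∈ R, x ∈ D r} x
      have := ind_le_one {x | ∀ r ∈ R, x ∈ D r} x
      nlinarith [hf x]) (by
      intro φ hp
      have := ih (fun r => {x | sub φ x ∈ D r}) (fun x => f (sub φ x)) (by
        intro r x y hxy hx
        refine hD r _ _ ?_ hx
        intro i
        simp only [sub]
        cases φ i with
        | inl a => rfl
        | inr e => exact hxy e) (fun x => hf _) (by
        intro ψ hψ
        have := hφ (comp φ ψ) (hp.comp hψ)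
        simpa only [sub_comp] using this)
      rw [av_sub, av_const]
      have e : (av fun v => ind {x | ∀ r ∈ R, x ∈ D r} (sub φ v) * f (sub φ v)) =
        av fun x => ind {x | ∀ r ∈ R, x ∈ {x | sub φ x ∈ D r}} x * f (sub φ x) := rfl
      rw [e]
      linarith)
    have e : (fun x => ind {x | ∀ r ∈ insert r0 R, x ∈ D r} x * f x) =
        fun x => ind (D r0) x * (ind {x | ∀ r ∈ R, x ∈ D r} x * f x - η / 2) + η / 2 * ind (D r0) x := by
      funext x
      simp only [ind, Set.mem_setOf_eq, Finset.forall_mem_insert]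
      by_cases h1 : x ∈ D r0 <;> by_cases h2 : ∀ r ∈ R, x ∈ D r <;> simp [h1, h2]
    rw [e, av_add, av_mul]
    have : av (ind (D r0)) ≤ 1 := av_le_of_le (ind_le_one _)
    nlinarith

end DHJ


end

section

open scoped Classical
open MeasureTheory Filter Topology

namespace DHJ

lemma IS_sum {α : Type} [Finite α] {ι : Type} [Finite ι] (κ : ℝ) (f : (ι → Option α) → ℝ)
    (h : ∀ D : α → Set (ι → Option α), (∀ r, Ins r (D r)) →
      av (fun x => ind {x | ∀ r, x ∈ D r} x * f x) ≤ κ)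
    (C : α → Set (ι → Option α)) (hC : ∀ r, Ins r (C r)) (R : Finset α) :
    av (fun x => (1 - ind {x | ∀ r ∈ R, x ∈ C r} x) * f x) ≤ R.card * κ := by
  induction R using Finset.induction_on with
  | empty =>
    simp [ind]
    unfold av
    simp
  | insert r0 R hr0 ih =>
    have h1 := h (fun r => if r ∈ R then C r else if r = r0 then (C r)ᶜ else Set.univ) (by
      intro r
      split_ifs
      · exact hC r
      · intro x y hxy hx hy
        exact hx (((hC r).eqv hxy).2 hy)
      · intro x y hxy hx
        trivial)
    have e : (fun x => (1 - ind {x | ∀ r ∈ insert r0 R, x ∈ C r} x) * f x) =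
        fun x => (1 - ind {x | ∀ r ∈ R, x ∈ C r} x) * f x + 
          ind {x | ∀ r, x ∈ (if r ∈ R then C r else if r = r0 then (C r)ᶜ else Set.univ)} x * f x := by
      funext x
      rw [← add_mul]
      congr 1
      have e2 : (∀ r, x ∈ (if r ∈ R then C r else if r = r0 then (C r)ᶜ else Set.univ)) ↔
          (∀ r ∈ R, x ∈ C r) ∧ x ∉ C r0 := by
        constructor
        · intro H
          refine ⟨fun r hr => by simpa [hr] using H r, by simpa [hr0] using H r0⟩
        · rintro ⟨H1, H2⟩ r
          split_ifs with h1 h2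
          · exact H1 r h1
          · subst h2; exact H2
          · trivial
      simp only [ind, Set.mem_setOf_eq, Finset.forall_mem_insert, e2]
      by_cases h1 : x ∈ C r0 <;> by_cases h2 : ∀ r ∈ R, x ∈ C r <;> simp [h1, h2]
    rw [e, av_add, Finset.card_insert_of_notMem hr0]
    push_cast
    linarith

/-- the point of the big cube -/
def Xpt {α M : Type} {n1 : ℕ} (ty : Fin n1 → M → Option α) (U : Fin n1 → Option α) :
    (Fin n1 × M) ⊕ Fin n1 → Option α
  | Sum.inl (j, i) => (ty j i).elim (U j) some
  | Sum.inr j => U j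

def Uf {α : Type} {n1 : ℕ} (φ : Fin n1 → α ⊕ Unit) (b : Option α) : Fin n1 → Option α :=
  fun j => Sum.elim some (fun _ => b) (φ j)

lemma av_resample {M β : Type} [Finite M] [Finite β] [Nonempty β] {n1 : ℕ} (j0 : Fin n1)
    (F : (Fin n1 → M → β) → ℝ) :
    av F = av fun ty => av fun z => F (Function.update ty j0 z) := by
  have key : av (fun p : (Fin n1 → M → β) × (M → β) => F p.1) =
      av (fun p : (Fin n1 → M → β) × (M → β) => F (Function.update p.1 j0 p.2)) := by
    let e : ((Fin n1 → M → β) × (M → β)) ≃ ((Fin n1 → M → β) × (M → β)) :=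
      { toFun := fun p => (Function.update p.1 j0 p.2, p.1 j0)
        invFun := fun p => (Function.update p.1 j0 p.2, p.1 j0)
        left_inv := fun p => by simp
        right_inv := fun p => by simp }
    rw [← av_equiv e (fun p => F p.1)]
    rfl
  rw [av_prod, av_prod] at key
  rw [← key]
  congr 1
  funext x
  exact (av_const _).symm

set_option maxHeartbeats 1000000 in
/-- the contradiction at the heart of the induction step -/
lemma core {α : Type} [Fintype α] [Nonempty α] {M Q : Type} [Finite M] [Finite Q] {n0 n1 : ℕ}
    {δ θ κ ε ρ : ℝ} (hδ : 0 < δ) (hθ : 0 < θ) (hκ : 0 < κ) (hκ2 : (Nat.card α + 1) * κ < δ * θ / 2)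
    (hρ : ρ = δ + ε) (hε : 0 < ε) (hε1 : 2 * ε ≤ κ * (θ / 2)) (hε2 : ε ≤ δ / 2)
    (hn1 : HJ α Unit (δ / 4) (Fin n1)) (hθdef : θ = δ / 4 / Nat.card (Fin n1 → α ⊕ Unit))
    (hn0 : HJ (Option α) Unit ρ (Fin n0)) (hM : n0 ≤ Nat.card M)
    (hIS : ∀ (D : α → Set (M → Option α))
      (f : (M → Option α) → ℝ), (∀ r, Ins r (D r)) → (∀ x, f x ≤ 1) →
      (∀ (φ : M → Option α ⊕ Fin n0), Proper φ → av (fun v => f (sub φ v)) ≤ 0) →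
      av (fun x => ind {x | ∀ r, x ∈ D r} x * f x) ≤ κ)
    (A : Set (((Fin n1 × M) ⊕ Fin n1) ⊕ Q → Option α)) (hA : ¬ HasSub Unit A)
    (hsec : ∀ x, δ - ε ≤ av fun y : Q → Option α => ind A (Sum.elim x y)) : False := by
  have hnl : 0 < (Nat.card (Fin n1 → α ⊕ Unit) : ℝ) := by exact_mod_cast Nat.card_pos
  -- find the line
  obtain ⟨φ, hφ⟩ : ∃ φ : Fin n1 → α ⊕ Unit, Proper φ ∧
      θ ≤ av fun ty : Fin n1 → M → Option α => av fun y : Q → Option α =>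
        ind {p : (Fin n1 → M → Option α) × (Q → Option α) |
          ∀ r : α, Sum.elim (Xpt p.1 (Uf φ (some r))) p.2 ∈ A} (ty, y) := by
    have h1 : δ / 2 ≤ av fun p : (Fin n1 → M → Option α) × (Q → Option α) =>
        av fun w : Fin n1 → α => ind A (Sum.elim (Xpt p.1 (fun j => some (w j))) p.2) := by
      rw [av_comm]
      have : ∀ w : Fin n1 → α, δ - ε ≤ av fun p : (Fin n1 → M → Option α) × (Q → Option α) =>
         ind A (Sum.elim (Xpt p.1 (fun j => some (w j))) p.2) := by
        intro w
        rw [av_prod]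
        exact le_trans (le_of_eq (av_const (δ - ε)).symm) (av_mono fun ty : Fin n1 → M → Option α =>
          hsec (Xpt ty (fun j => some (w j))))
      refine le_trans (by linarith) (le_trans (le_of_eq (av_const (δ - ε)).symm) (av_mono this))
    have h2 := markov (Y := (Fin n1 → M → Option α) × (Q → Option α)) (fun y => av_le_of_le fun x => ind_le_one A _) (by linarith) h1
    obtain ⟨φ, hφ⟩ := pigeon (Y := (Fin n1 → M → Option α) × (Q → Option α)) (L := Fin n1 → α ⊕ Unit)
      {p | δ / 2 / 2 ≤ av fun w : Fin n1 → α => ind A (Sum.elim (Xpt p.1 (fun j => some (w j))) p.2)}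
      (fun (p : (Fin n1 → M → Option α) × (Q → Option α)) φ => Proper φ ∧ ∀ v, Sum.elim (Xpt p.1 (fun j => some (sub φ v j))) p.2 ∈ A) (by
        intro p hp
        refine hn1 {w | Sum.elim (Xpt p.1 (fun j => some (w j))) p.2 ∈ A} ?_
        simp only [Set.mem_setOf_eq] at hp
        rw [show δ / 4 = δ / 2 / 2 by ring]
        exact hp)
    have h3 : θ ≤ av (ind {y : (Fin n1 → M → Option α) × (Q → Option α) |
        Proper φ ∧ ∀ v, Sum.elim (Xpt y.1 (fun j => some (sub φ v j))) y.2 ∈ A}) := by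
      refine le_trans ?_ hφ
      rw [hθdef]
      apply div_le_div_of_nonneg_right _ hnl.le
      linarith
    refine ⟨φ, ?_, ?_⟩
    · by_contra hno
      simp only [hno, false_and, ind, Set.mem_setOf_eq, if_false] at h3
      have e : (av (ind {y : (Fin n1 → M → Option α) × (Q → Option α) | False})) = 0 := by
        simp [ind, av_const, av]
      linarith
    · rw [← av_prod]
      refine h3.trans (av_mono fun p => ?_)
      unfold ind
      split_ifs with h4 h5
      · exact le_rfl
      · exfalso
        apply h5
        intro r
        convert h4.2 (fun _ => r) using 3
        funext j
        simp only [Uf, sub]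
        cases φ j <;> rfl
      · norm_num
      · norm_num
  obtain ⟨hφ, hθle⟩ := hφ
  obtain ⟨j0, hj0⟩ := hφ ()
  -- objects
  set W : (Fin n1 → M → Option α) → (Q → Option α) → Option α → (M → Option α) →
    (((Fin n1 × M) ⊕ Fin n1) ⊕ Q → Option α) :=
    fun ty y b z => Sum.elim (Xpt (Function.update ty j0 z) (Uf φ b)) y with hW
  set f : (Fin n1 → M → Option α) → (Q → Option α) → ℝ := fun ty y =>
    av (ind {z | ∀ r ∈ (Finset.univ : Finset α), z ∈ {z | W ty y (some r) z ∈ A}}) with hf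
  set g : (Fin n1 → M → Option α) → (Q → Option α) → ℝ := fun ty y =>
    av (ind {z | W ty y none z ∈ A}) with hg
  have hfav : θ ≤ av fun ty => av fun y => f ty y := by
    refine hθle.trans (le_of_eq ?_)
    rw [av_resample j0]
    congr 1
    funext ty
    rw [av_comm]
    congr 1
    funext y
    simp only [hf]
    congr 1
    funext z
    simp [ind, hW]
  have hgav : δ - ε ≤ av fun ty => av fun y => g ty y := by
    have : (av fun ty => av fun y => g ty y) = av fun ty : Fin n1 → M → Option α =>
      av fun y : Q → Option α => ind A (Sum.elim (Xpt ty (Uf φ none)) y) := by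
      symm
      refine (av_resample j0 _).trans ?_
      congr 1
      funext ty
      rw [av_comm]
      rfl
    rw [this]
    exact le_trans (le_of_eq (av_const (δ - ε)).symm) (av_mono fun ty => hsec _)
  have hpull : ∀ ty y, ∃ ψ : ((Fin n1 × M) ⊕ Fin n1) ⊕ Q → Option α ⊕ M, Proper ψ ∧
      ∀ z, sub ψ z = W ty y none z := by
    intro ty y
    refine ⟨Sum.elim (Sum.elim (fun p => if p.1 = j0 then Sum.inr p.2 else
      Sum.inl ((ty p.1 p.2).elim (Uf φ none p.1) some)) (fun j => Sum.inl (Uf φ none j)))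
      (fun q => Sum.inl (y q)), ?_, ?_⟩
    · intro i
      exact ⟨Sum.inl (Sum.inl (j0, i)), by simp⟩
    · intro z
      funext q
      rcases q with (⟨j, i⟩ | j) | q
      · simp only [hW, sub, Sum.elim_inl, Xpt]
        by_cases hj : j = j0
        · subst hj
          simp only [if_true, Sum.elim_inr, Function.update_self, Uf, hj0]
          cases z i <;> rfl
        · simp [hj]
      · rfl
      · rfl
  have hLF : ∀ ty y, ¬ HasSub Unit {z | W ty y none z ∈ A} := by
    intro ty y H
    obtain ⟨ψ, h1, h2⟩ := hpull ty y
    simp_rw [← h2] at H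
    exact hA (H.pull h1)
  have hgρ : ∀ ty y, g ty y ≤ ρ := by
    intro ty y
    by_contra! H
    exact hLF ty y ((hn0.card hM) _ H.le)
  obtain ⟨⟨ty, y⟩, hty⟩ : ∃ p : (Fin n1 → M → Option α) × (Q → Option α),
      κ * (θ / 2) ≤ κ * f p.1 p.2 + (g p.1 p.2 - ρ) := by
    apply exists_ge_av
    rw [av_add, av_sub, av_mul, av_const, av_prod, av_prod]
    have := mul_le_mul_of_nonneg_left hfav hκ.le
    simp only
    linarith
  simp only at hty
  have hf1 : f ty y ≤ 1 := av_le_of_le (ind_le_one _)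
  have hfθ : θ / 2 ≤ f ty y := by
    have := hgρ ty y
    have : κ * (θ / 2) ≤ κ * f ty y := by linarith
    exact le_of_mul_le_mul_left this hκ
  have hgκ : ρ - κ ≤ g ty y := by
    have : κ * f ty y ≤ κ * 1 := mul_le_mul_of_nonneg_left hf1 hκ.le
    have : 0 ≤ κ * (θ / 2) := by positivity
    linarith
  have hCI : ∀ r : α, Ins r {z | W ty y (some r) z ∈ A} := by
    intro r z z' hz hzA
    simp only [Set.mem_setOf_eq] at hzA ⊢
    have : W ty y (some r) z = W ty y (some r) z' := by
      funext q
      rcases q with (⟨j, i⟩ | j) | q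
      · simp only [hW, Sum.elim_inl, Xpt]
        by_cases hj : j = j0
        · subst hj
          have := hz i
          simp only [Function.update_self, Uf, hj0, Sum.elim_inr]
          cases h1 : z i <;> cases h2 : z' i <;> simp_all
        · simp [hj]
      · rfl
      · rfl
    rwa [← this]
  have hdisj : ∀ z, z ∈ {z | W ty y none z ∈ A} → ¬ (∀ r, z ∈ {z | W ty y (some r) z ∈ A}) := by
    intro z hz1 hz2
    apply hA
    refine ⟨Sum.elim (Sum.elim (fun p => ((Function.update ty j0 z) p.1 p.2).elim
      (Sum.map some id (φ p.1)) (fun a => Sum.inl (some a))) (fun j => Sum.map some id (φ j)))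
      (fun q => Sum.inl (y q)), ?_, ?_⟩
    · intro i
      exact ⟨Sum.inl (Sum.inr j0), by simp [hj0]⟩
    · intro v
      have : W ty y (v ()) z ∈ A := by
        cases hv : v () with
        | none => exact hz1
        | some r => exact hz2 r
      convert this using 1
      funext q
      rcases q with (⟨j, i⟩ | j) | q
      · simp only [hW, sub, Sum.elim_inl, Xpt, Uf]
        cases h1 : Function.update ty j0 z j i with
        | none => cases φ j <;> simp
        | some a => simp
      · simp only [hW, sub, Sum.elim_inl, Sum.elim_inr, Xpt, Uf]
        cases φ j <;> simp
      · rfl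
  have hfin := IS_sum κ (fun z => ind {z | W ty y none z ∈ A} z - ρ) (by
    intro D hD
    refine hIS D _ hD ?_ ?_
    · intro z
      have := ind_le_one {z | W ty y none z ∈ A} z
      have : 0 < ρ := by linarith
      linarith
    · intro ψ hψ
      rw [av_sub, av_const]
      by_contra! H
      refine hLF ty y (HasSub.pull hψ (hn0 _ ?_))
      have e : (av fun v => ind {z | W ty y none z ∈ A} (sub ψ v)) =
        av (ind {z | sub ψ z ∈ {z | W ty y none z ∈ A}}) := rfl
      rw [e] at H
      linarith) (fun r => {z | W ty y (some r) z ∈ A}) hCI (Finset.univ : Finset α)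
  have e1 : (fun x => (1 - ind {x | ∀ r ∈ (Finset.univ : Finset α), x ∈ {z | W ty y (some r) z ∈ A}} x) *
      (ind {z | W ty y none z ∈ A} x - ρ)) = fun x => (ind {z | W ty y none z ∈ A} x - ρ) +
      ρ * ind {x | ∀ r ∈ (Finset.univ : Finset α), x ∈ {z | W ty y (some r) z ∈ A}} x := by
    funext x
    have : ind {z | W ty y none z ∈ A} x * ind {x | ∀ r ∈ (Finset.univ : Finset α), x ∈ {z | W ty y (some r) z ∈ A}} x = 0 := by
      unfold ind
      by_cases h1 : x ∈ {z | W ty y none z ∈ A}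
      · have h2 := hdisj x h1
        have h3 : x ∉ {x | ∀ r ∈ (Finset.univ : Finset α), x ∈ {z | W ty y (some r) z ∈ A}} := by
          intro h3
          exact h2 fun r => h3 r (Finset.mem_univ r)
        rw [if_neg h3, mul_zero]
      · rw [if_neg h1, zero_mul]
    linarith
  rw [e1, av_add, av_sub, av_const, av_mul] at hfin
  have e2 : (av fun x => ind {x | ∀ r ∈ (Finset.univ : Finset α), x ∈ {z | W ty y (some r) z ∈ A}} x) = f ty y := rfl
  have e3 : (av fun x => ind {z | W ty y none z ∈ A} x) = g ty y := rfl
  have e4 : ((Finset.univ : Finset α).card : ℝ) = Nat.card α := by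
    simp
  rw [e2, e3, e4] at hfin
  have : δ * (θ / 2) ≤ ρ * f ty y := by
    apply mul_le_mul <;> first | linarith | positivity
  linarith

lemma step {α : Type} [Fintype α] [Nonempty α] (hα : DHJ α) : DHJ (Option α) := by
  by_contra hno
  unfold DHJ at hno
  push Not at hno
  obtain ⟨δ0, hδ0, hno⟩ := hno
  set Δ : Set ℝ := {δ | ∃ n : ℕ, HJ (Option α) Unit δ (Fin n)} with hΔ
  have hup : ∀ a b, a ≤ b → a ∈ Δ → b ∈ Δ := fun a b hab ⟨n, hn⟩ =>
    ⟨n, fun A hA => hn A (hab.trans hA)⟩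
  have h2 : (2:ℝ) ∈ Δ := ⟨0, fun A hA => by
    have : av (ind A) ≤ 1 := av_le_of_le (ind_le_one _)
    linarith⟩
  have hlb : ∀ b ∈ Δ, δ0 ≤ b := by
    intro b hb
    by_contra! H
    obtain ⟨n, hn⟩ := hup b δ0 H.le hb
    exact hno n hn
  have hbdd : BddBelow Δ := ⟨δ0, hlb⟩
  set δ := sInf Δ with hδdef
  have hδ : 0 < δ := lt_of_lt_of_le hδ0 (le_csInf ⟨2, h2⟩ hlb)
  have hplus : ∀ e > 0, δ + e ∈ Δ := by
    intro e he
    obtain ⟨b, hb, hb2⟩ := exists_lt_of_csInf_lt ⟨2, h2⟩ (show sInf Δ < δ + e by linarith)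
    exact hup b _ hb2.le hb
  have hminus : ∀ e > 0, δ - e ∉ Δ := by
    intro e he h
    have := csInf_le hbdd h
    linarith
  obtain ⟨n1, hn1⟩ := hα (δ / 4) (by positivity)
  have hnl : 0 < (Nat.card (Fin n1 → α ⊕ Unit) : ℝ) := by exact_mod_cast Nat.card_pos
  set θ := δ / 4 / Nat.card (Fin n1 → α ⊕ Unit) with hθ
  have hθ0 : 0 < θ := by positivity
  set κ := min (δ * θ / (2 * (Nat.card α + 2))) (1 / 2) with hκ
  have hκ0 : 0 < κ := lt_min (by positivity) (by norm_num)
  set ε := min (κ * θ / 4) (δ / 2) with hε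
  have hε0 : 0 < ε := lt_min (by positivity) (by positivity)
  obtain ⟨n0, hn0⟩ := hplus ε hε0
  obtain ⟨M, hM, hIS⟩ := IS hα n0 Finset.univ κ hκ0
  have hMc : n0 ≤ Nat.card M := by
    by_contra! H
    have := hIS (fun _ => Set.univ) (fun _ => 1) (fun r x y _ _ => trivial) (fun _ => le_rfl) (by
      intro φ hφ
      exfalso
      choose s hs using hφ
      have hinj : Function.Injective s := fun a b hab => by
        have := (hs a).symm.trans ((congrArg φ hab).trans (hs b))
        simpa using this
      have := Nat.card_le_card_of_injective s hinj
      simp at this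
      omega)
    simp only [Set.mem_univ, implies_true, Set.setOf_true, ind, if_true, mul_one, av_const] at this
    have h3 : κ ≤ 1 / 2 := min_le_right _ _
    linarith
  have hN : 0 < (Nat.card ((Fin n1 × M) ⊕ Fin n1 → Option α) : ℝ) := by exact_mod_cast Nat.card_pos
  set ε1 := ε / (2 * Nat.card ((Fin n1 × M) ⊕ Fin n1 → Option α)) with hε1
  have hε10 : 0 < ε1 := by positivity
  obtain ⟨n2, hn2⟩ := hplus ε1 hε10
  have hnot : ¬ HJ (Option α) Unit (δ - ε1) (((Fin n1 × M) ⊕ Fin n1) ⊕ Fin n2) := by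
    intro H
    exact hminus ε1 hε10 ⟨_, H.equiv (Finite.equivFin _)⟩
  unfold HJ at hnot
  push Not at hnot
  obtain ⟨A, hAd, hA⟩ := hnot
  refine core (ε := ε) (ρ := δ + ε) hδ hθ0 hκ0 ?_ rfl hε0 ?_ (min_le_right _ _) hn1 hθ hn0 hMc
    (fun D f hD hf hφ => ?_) A hA ?_
  · have h3 : κ ≤ δ * θ / (2 * (Nat.card α + 2)) := min_le_left _ _
    rw [le_div_iff₀ (by positivity)] at h3
    nlinarith
  · have : ε ≤ κ * θ / 4 := min_le_left _ _
    linarith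
  · have := hIS D f hD hf hφ
    simpa using this
  · intro x
    rw [av_sumArrow] at hAd
    have h3 := le_of_av_ge (M := δ + ε1) (t := 2 * ε1) (h := fun x => av fun y : Fin n2 → Option α => ind A (Sum.elim x y))
      (by
        intro x
        by_contra! H
        refine hA (HasSub.pull (φ := Sum.elim (fun i => Sum.inl (x i)) (fun q => Sum.inr q)) ?_ (hn2 _ (H.le.trans (le_of_eq ?_))))
        · intro e
          exact ⟨Sum.inr e, rfl⟩
        · congr 1
          funext y
          have : Sum.elim x y = sub (Sum.elim (fun i => Sum.inl (x i)) (fun q => Sum.inr q)) y := by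
            funext i
            cases i <;> rfl
          rw [this]
          rfl) (by linarith) x
    have h4 : (Nat.card ((Fin n1 × M) ⊕ Fin n1 → Option α) : ℝ) * (2 * ε1) = ε := by
      rw [hε1]; field_simp
    rw [h4] at h3
    linarith

lemma DHJ.equiv {α β : Type} [Finite α] [Finite β] (e : α ≃ β) (h : DHJ α) : DHJ β := by
  intro δ hδ
  obtain ⟨n, hn⟩ := h δ hδ
  refine ⟨n, fun A hA => ?_⟩
  obtain ⟨φ, h1, h2⟩ := hn {x | (fun i => e (x i)) ∈ A} (by
    refine hA.trans (le_of_eq ?_)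
    rw [← av_equiv (Equiv.arrowCongr (Equiv.refl _) e)]
    rfl)
  refine ⟨fun i => Sum.map e id (φ i), ?_, ?_⟩
  · intro u
    obtain ⟨i, hi⟩ := h1 u
    exact ⟨i, by simp [hi]⟩
  · intro v
    have h3 : (fun i => e (sub φ (fun u => e.symm (v u)) i)) ∈ A := h2 (fun u => e.symm (v u))
    convert h3 using 1
    funext i
    simp only [sub]
    cases φ i <;> simp

theorem dhj (k : ℕ) : DHJ (Fin (k + 1)) := by
  induction k with
  | zero =>
    intro δ hδ
    refine ⟨1, fun A hA => ?_⟩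
    obtain ⟨x, hx⟩ := exists_ge_av hA
    have hxA : x ∈ A := by
      by_contra h
      simp [ind, h] at hx
      linarith
    refine ⟨fun i => Sum.inr (), fun e => ⟨0, rfl⟩, fun v => ?_⟩
    convert hxA
    funext i
    exact Subsingleton.elim (α := Fin 1) _ _
  | succ k ih => exact DHJ.equiv (finSuccEquiv (k + 1)).symm (step ih)

end DHJ


end

section

open scoped Classical
open MeasureTheory Filter Topology

namespace DHJ

lemma zIter_add {X : Type*} (T : Equiv.Perm X) (m n : ℤ) (x : X) :
    zIter T (m + n) x = zIter T m (zIter T n x) := by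
  simp [zIter, zpow_add]

lemma zIter_zero {X : Type*} (T : Equiv.Perm X) (x : X) : zIter T 0 x = x := by simp [zIter]

lemma zIter_one {X : Type*} (T : Equiv.Perm X) (x : X) : zIter T 1 x = T x := by simp [zIter]

lemma mp_zIter {Y : Type} [MeasurableSpace Y] {μ : Measure Y} (T : Y ≃ᵐ Y)
    (hT : MeasurePreserving (⇑T) μ μ) (n : ℤ) : MeasurePreserving (zIter T.toEquiv n) μ μ := by
  induction n using Int.induction_on with
  | zero =>
    have : zIter T.toEquiv 0 = id := funext fun x => zIter_zero _ x
    rw [this]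
    exact MeasurePreserving.id μ
  | succ n ih =>
    have : zIter T.toEquiv (n + 1) = T ∘ zIter T.toEquiv n := by
      funext x
      rw [add_comm, zIter_add, zIter_one]
      rfl
    rw [this]
    exact hT.comp ih
  | pred n ih =>
    have : zIter T.toEquiv (-n - 1) = T.symm ∘ zIter T.toEquiv (-n) := by
      funext x
      apply T.injective
      have h := zIter_add T.toEquiv 1 (-n - 1) x
      rw [zIter_one, show (1 + (-(n:ℤ) - 1)) = -n by ring] at h
      simp only [Function.comp_apply, MeasurableEquiv.apply_symm_apply]
      exact h.symm
    rw [this]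
    exact (MeasurePreserving.symm T hT).comp ih

section
variable {Y : Type} [MeasurableSpace Y] {μ : Measure Y} [IsProbabilityMeasure μ]

lemma integrable_ind {E : Set Y} (hE : MeasurableSet E) : Integrable (ind E) μ := by
  have : ind E = E.indicator (fun _ => (1:ℝ)) := by
    funext y; simp [ind, Set.indicator]
  rw [this]
  exact (integrable_const 1).indicator hE

lemma integral_ind {E : Set Y} (hE : MeasurableSet E) : ∫ y, ind E y ∂μ = μ.real E := by
  have : ind E = E.indicator (fun _ => (1:ℝ)) := by
    funext y; simp [ind, Set.indicator]
  rw [this, integral_indicator hE]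
  simp

lemma integrable_av {I : Type} [Finite I] {E : I → Set Y} (hE : ∀ i, MeasurableSet (E i)) :
    Integrable (fun y => av fun i => ind (E i) y) μ := by
  letI := Fintype.ofFinite I
  simp_rw [av_eq]
  exact (integrable_finset_sum _ fun i _ => integrable_ind (hE i)).div_const _

lemma integral_av {I : Type} [Finite I] {E : I → Set Y} (hE : ∀ i, MeasurableSet (E i)) :
    ∫ y, (av fun i => ind (E i) y) ∂μ = av fun i => μ.real (E i) := by
  letI := Fintype.ofFinite I
  simp_rw [av_eq]
  rw [integral_div, integral_finset_sum _ fun i _ => integrable_ind (hE i)]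
  simp_rw [fun i => integral_ind (μ := μ) (hE i)]

lemma meas_line {K N : ℕ} [NeZero K] {δ : ℝ} (hδ : 0 < δ) (hN : HJ (Fin K) Unit (δ / 2) (Fin N))
    (B : (Fin N → Fin K) → Set Y) (hB : ∀ w, MeasurableSet (B w)) (hδB : ∀ w, δ ≤ μ.real (B w)) :
    δ / 2 ≤ ∑ φ : Fin N → Fin K ⊕ Unit, μ.real {y | Proper φ ∧ ∀ l, y ∈ B (sub φ (fun _ => l))} := by
  have hm : ∀ φ : Fin N → Fin K ⊕ Unit, MeasurableSet {y | Proper φ ∧ ∀ l, y ∈ B (sub φ (fun _ => l))} := by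
    intro φ
    have : {y | Proper φ ∧ ∀ l, y ∈ B (sub φ (fun _ => l))} =
        {y | Proper φ} ∩ ⋂ l, B (sub φ (fun _ => l)) := by ext; simp
    rw [this]
    exact (MeasurableSet.const _).inter (MeasurableSet.iInter fun l => hB _)
  have key : ∀ y, (av fun w => ind (B w) y) ≤ δ / 2 +
      ∑ φ : Fin N → Fin K ⊕ Unit, ind {y | Proper φ ∧ ∀ l, y ∈ B (sub φ (fun _ => l))} y := by
    intro y
    by_cases h : δ / 2 ≤ av fun w => ind (B w) y
    · obtain ⟨φ, h1, h2⟩ := hN {w | y ∈ B w} h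
      have h3 : ind {y | Proper φ ∧ ∀ l, y ∈ B (sub φ (fun _ => l))} y ≤
        ∑ φ : Fin N → Fin K ⊕ Unit, ind {y | Proper φ ∧ ∀ l, y ∈ B (sub φ (fun _ => l))} y :=
        Finset.single_le_sum (f := fun φ : Fin N → Fin K ⊕ Unit =>
          ind {y | Proper φ ∧ ∀ l, y ∈ B (sub φ (fun _ => l))} y)
          (fun i _ => ind_nonneg _ _) (Finset.mem_univ φ)
      have h4 : ind {y | Proper φ ∧ ∀ l, y ∈ B (sub φ (fun _ => l))} y = 1 := by
        unfold ind
        rw [if_pos]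
        exact ⟨h1, fun l => h2 _⟩
      have h5 : (av fun w => ind (B w) y) ≤ 1 := av_le_of_le fun w => ind_le_one _ _
      linarith
    · have : 0 ≤ ∑ φ : Fin N → Fin K ⊕ Unit, ind {y | Proper φ ∧ ∀ l, y ∈ B (sub φ (fun _ => l))} y :=
        Finset.sum_nonneg fun i _ => ind_nonneg _ _
      linarith
  have h1 := integral_mono (μ := μ) (integrable_av hB) ((integrable_const (δ / 2)).add
    (integrable_finset_sum _ fun φ _ => integrable_ind (hm φ))) key
  rw [integral_av hB] at h1
  simp only [Pi.add_apply] at h1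
  rw [integral_add (integrable_const _) (integrable_finset_sum _ fun φ _ => integrable_ind (hm φ)),
    integral_finset_sum _ fun φ _ => integrable_ind (hm φ)] at h1
  simp_rw [fun i => integral_ind (μ := μ) (hm i)] at h1
  have h2 : δ ≤ av fun w => μ.real (B w) :=
    le_trans (le_of_eq (av_const δ).symm) (av_mono hδB)
  simp at h1
  linarith
end

/-- the coloring -/
lemma coloring (d N : ℕ) (hN : 1 ≤ N) (γ : ℝ) (hγ : 0 < γ) :
    ∃ M : ℕ, 1 ≤ M ∧ ∃ τ : (Fin (d + 1) → Fin M) → Fin N,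
      ∀ Q : Fin (d + 1) → (Fin (d + 1) → Fin M) → Prop,
        (∀ l a a', (∀ i, i ≠ l → a i = a' i) → Q l a → Q l a') →
        γ ≤ av (ind {a | ∀ l, Q l a}) → ∀ t, ∃ a, τ a = t ∧ ∀ l, Q l a := by
  obtain ⟨c, hc⟩ := exists_nat_gt (1 / γ)
  have hc0 : (0:ℝ) < c := lt_trans (by positivity) hc
  have hq0 : (0:ℝ) ≤ 1 - 1 / N := by
    have : (1:ℝ) ≤ N := by exact_mod_cast hN
    rw [sub_nonneg, div_le_one (by positivity)]
    exact this
  have hq1 : (1 - 1 / N : ℝ) < 1 := by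
    have : (1:ℝ) ≤ N := by exact_mod_cast hN
    have : (0:ℝ) < 1 / N := by positivity
    linarith
  obtain ⟨m, hm⟩ := exists_pow_lt_of_lt_one (show (0:ℝ) < 1 / (2 ^ (d + 1) * (N + 1)) by positivity) hq1
  set M := c * (m + 1) with hM
  have hM1 : 1 ≤ M := by
    have : 0 < c := by exact_mod_cast hc0
    exact Nat.mul_pos this (by omega)
  haveI : NeZero M := ⟨by omega⟩
  haveI : NeZero N := ⟨by omega⟩
  refine ⟨M, hM1, ?_⟩
  set q : ℝ := 1 - 1 / N with hq
  let Fam := (l : Fin (d + 1)) → Set ({i // i ≠ l} → Fin M)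
  let G : Fam → Set (Fin (d + 1) → Fin M) := fun g => {a | ∀ l, (fun i => a i.1) ∈ g l}
  -- probability bound
  have hprob : ∀ g : Fam, ∀ t : Fin N, γ ≤ av (ind (G g)) →
      av (ind {τ : (Fin (d + 1) → Fin M) → Fin N | ∀ a ∈ G g, τ a ≠ t}) ≤ q ^ (m * M ^ d) := by
    intro g t hg
    have h1 : ∀ τ : (Fin (d + 1) → Fin M) → Fin N,
        ind {τ : (Fin (d + 1) → Fin M) → Fin N | ∀ a ∈ G g, τ a ≠ t} τ =
        ∏ a, (if a ∈ G g ∧ τ a = t then (0:ℝ) else 1) := by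
      intro τ
      unfold ind
      split_ifs with h
      · rw [Finset.prod_eq_one]
        intro a _
        rw [if_neg]
        rintro ⟨h1, h2⟩
        exact h a h1 h2
      · simp only [Set.mem_setOf_eq] at h
        push Not at h
        obtain ⟨a, h1, h2⟩ := h
        rw [Finset.prod_eq_zero (Finset.mem_univ a)]
        simp [h1, h2]
    have h2 : av (ind {τ : (Fin (d + 1) → Fin M) → Fin N | ∀ a ∈ G g, τ a ≠ t}) =
        ∏ a : Fin (d + 1) → Fin M, av (fun b : Fin N => if a ∈ G g ∧ b = t then (0:ℝ) else 1) := by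
      rw [show ind {τ : (Fin (d + 1) → Fin M) → Fin N | ∀ a ∈ G g, τ a ≠ t} =
        fun τ => ∏ a, (if a ∈ G g ∧ τ a = t then (0:ℝ) else 1) from funext h1]
      simp_rw [av_eq]
      rw [Finset.prod_div_distrib, Finset.prod_univ_sum]
      congr 1
      · simp [Fintype.piFinset_univ]
    have h3 : ∀ a, av (fun b : Fin N => if a ∈ G g ∧ b = t then (0:ℝ) else 1) =
        if a ∈ G g then q else 1 := by
      intro a
      by_cases ha : a ∈ G g
      · have hN0 : (N:ℝ) ≠ 0 := by exact_mod_cast (by omega : N ≠ 0)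
        have : (fun b : Fin N => if a ∈ G g ∧ b = t then (0:ℝ) else 1) = fun b => 1 - if b = t then 1 else 0 := by
          funext b
          by_cases hb : b = t <;> simp [ha, hb]
        rw [this, av_sub, av_const, if_pos ha, av_eq]
        simp [hq]
      · simp [ha, av_const]
    rw [h2]
    simp_rw [h3]
    rw [Finset.prod_ite]
    simp only [Finset.prod_const, one_pow, mul_one]
    apply pow_le_pow_of_le_one hq0 hq1.le
    rw [av_eq] at hg
    have h4 : ∑ x, ind (G g) x = (Finset.univ.filter fun a => a ∈ G g).card := by
      simp only [ind, Finset.sum_boole]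
      congr!
    rw [h4, le_div_iff₀ (by exact_mod_cast Nat.card_pos)] at hg
    have h5 : (Nat.card (Fin (d + 1) → Fin M) : ℝ) = M ^ d * (c * (m + 1)) := by
      simp [pow_succ, hM]
    rw [h5] at hg
    have h6 : 1 ≤ γ * c := by
      rw [div_lt_iff₀ hγ] at hc
      linarith
    have h7 : (m * M ^ d : ℝ) ≤ (Finset.univ.filter fun a => a ∈ G g).card := by
      refine le_trans ?_ hg
      have : (0:ℝ) ≤ M ^ d := by positivity
      nlinarith [mul_nonneg this (by positivity : (0:ℝ) ≤ m + 1), mul_le_mul_of_nonneg_right h6 (mul_nonneg this (by positivity : (0:ℝ) ≤ m + 1))]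
    exact_mod_cast h7
  have hcard : Nat.card Fam = (2 ^ (d + 1)) ^ (M ^ d) := by
    have : ∀ l : Fin (d + 1), Nat.card (Set ({i // i ≠ l} → Fin M)) = 2 ^ (M ^ d) := by
      intro l
      rw [Nat.card_eq_fintype_card, Fintype.card_set, Fintype.card_fun]
      simp
    simp only [Fam, Nat.card_pi, this]
    simp
    rw [← pow_mul, ← pow_mul, mul_comm]
  have hfin : Finite Fam := by infer_instance
  letI : Fintype Fam := Fintype.ofFinite Fam
  obtain ⟨τ, hτ⟩ : ∃ τ : (Fin (d + 1) → Fin M) → Fin N,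
      -(N * ((2:ℝ) ^ (d + 1)) ^ (M ^ d) * q ^ (m * M ^ d)) ≤ 
      - ∑ p : Fam × Fin N, if γ ≤ av (ind (G p.1)) then
        ind {τ : (Fin (d + 1) → Fin M) → Fin N | ∀ a ∈ G p.1, τ a ≠ p.2} τ else 0 := by
    apply exists_ge_av
    have e : (av fun τ : (Fin (d + 1) → Fin M) → Fin N => - ∑ p : Fam × Fin N, if γ ≤ av (ind (G p.1)) then
        ind {τ : (Fin (d + 1) → Fin M) → Fin N | ∀ a ∈ G p.1, τ a ≠ p.2} τ else 0) =
        - ∑ p : Fam × Fin N, av (fun τ : (Fin (d + 1) → Fin M) → Fin N => if γ ≤ av (ind (G p.1)) then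
        ind {τ : (Fin (d + 1) → Fin M) → Fin N | ∀ a ∈ G p.1, τ a ≠ p.2} τ else 0) := by
      rw [← av_finsum, ← neg_one_mul, ← av_mul]
      simp
    rw [e, neg_le_neg_iff]
    have : ∀ p ∈ (Finset.univ : Finset (Fam × Fin N)), av (fun τ : (Fin (d + 1) → Fin M) → Fin N => if γ ≤ av (ind (G p.1)) then
        ind {τ : (Fin (d + 1) → Fin M) → Fin N | ∀ a ∈ G p.1, τ a ≠ p.2} τ else 0) ≤ q ^ (m * M ^ d) := by
      intro p _
      by_cases hp : γ ≤ av (ind (G p.1))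
      · simp only [hp, if_true]
        exact hprob p.1 p.2 hp
      · simp only [hp, if_false]
        rw [av_const]
        positivity
    refine (Finset.sum_le_card_nsmul _ _ _ this).trans (le_of_eq ?_)
    rw [Finset.card_univ, Fintype.card_prod, ← Nat.card_eq_fintype_card, hcard, nsmul_eq_mul]
    push_cast
    rw [Fintype.card_fin]
    ring
  refine ⟨τ, fun Q hQ hγQ t => ?_⟩
  by_contra! hno
  let g : Fam := fun l => {b | ∃ a, Q l a ∧ (fun i : {i // i ≠ l} => a i.1) = b}
  have hgG : G g = {a | ∀ l, Q l a} := by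
    ext a
    simp only [G, g, Set.mem_setOf_eq]
    refine forall_congr' fun l => ⟨?_, fun h => ⟨a, h, rfl⟩⟩
    rintro ⟨a', h1, h2⟩
    exact hQ l a' a (fun i hi => congrFun h2 ⟨i, hi⟩) h1
  have h1 : (1:ℝ) ≤ ∑ p : Fam × Fin N, if γ ≤ av (ind (G p.1)) then
        ind {τ : (Fin (d + 1) → Fin M) → Fin N | ∀ a ∈ G p.1, τ a ≠ p.2} τ else 0 := by
    refine le_trans (le_of_eq ?_) (Finset.single_le_sum (f := fun p : Fam × Fin N => if γ ≤ av (ind (G p.1)) then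
        ind {τ : (Fin (d + 1) → Fin M) → Fin N | ∀ a ∈ G p.1, τ a ≠ p.2} τ else 0) ?_ (Finset.mem_univ (g, t)))
    · simp only [hgG, if_pos hγQ, ind]
      rw [if_pos]
      intro a ha hat
      obtain ⟨l, hl⟩ := hno a hat
      exact hl (ha l)
    · intro p _
      split_ifs
      · exact ind_nonneg _ _
      · exact le_rfl
  have h2 : N * ((2:ℝ) ^ (d + 1)) ^ (M ^ d) * q ^ (m * M ^ d) < 1 := by
    rw [pow_mul, mul_assoc, ← mul_pow]
    have h3 : (2:ℝ) ^ (d + 1) * q ^ m ≤ 1 / (N + 1) := by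
      rw [lt_div_iff₀ (by positivity)] at hm
      rw [le_div_iff₀ (by positivity)]
      linarith
    have h4 : ((2:ℝ) ^ (d + 1) * q ^ m) ^ (M ^ d) ≤ 1 / (N + 1) := by
      refine le_trans (pow_le_pow_left₀ (by positivity) h3 _) ?_
      refine pow_le_of_le_one (by positivity) ?_ (by positivity)
      rw [div_le_one (by positivity)]
      linarith [(by positivity : (0:ℝ) ≤ N)]
    have h5 : (N:ℝ) * (1 / (N + 1)) < 1 := by
      rw [mul_one_div, div_lt_one (by positivity)]
      linarith
    exact lt_of_le_of_lt (mul_le_mul_of_nonneg_left h4 (by positivity)) h5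
  linarith

end DHJ


end

section

open scoped Classical
open MeasureTheory Filter Topology

namespace DHJ

section
variable {Y : Type} [MeasurableSpace Y] {μ : Measure Y} [IsProbabilityMeasure μ]

lemma meas_shift (T : Y ≃ᵐ Y) (hT : MeasurePreserving (⇑T) μ μ) {A : Set Y} (hA : MeasurableSet A)
    {K : ℕ} (n C : ℤ) (c : Fin K → ℤ) (hc : ∀ l, c l = (l : ℤ) * n + C) :
    MeasurableSet {y | ∀ l, zIter T.toEquiv (c l) y ∈ A} ∧ μ {y | ∀ l, zIter T.toEquiv (c l) y ∈ A} =
      μ {y | ∀ l : Fin K, zIter T.toEquiv ((l : ℤ) * n) y ∈ A} := by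
  have hm : ∀ c : Fin K → ℤ, MeasurableSet {y | ∀ l, zIter T.toEquiv (c l) y ∈ A} := by
    intro c
    have : {y | ∀ l, zIter T.toEquiv (c l) y ∈ A} = ⋂ l, zIter T.toEquiv (c l) ⁻¹' A := by
      ext; simp
    rw [this]
    exact MeasurableSet.iInter fun l => (mp_zIter T hT _).measurable hA
  refine ⟨hm c, ?_⟩
  rw [← (mp_zIter T hT C).measure_preimage (hm fun l => (l : ℤ) * n).nullMeasurableSet]
  congr 1
  ext y
  simp only [Set.mem_setOf_eq, Set.mem_preimage, hc, zIter_add]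

end

lemma line_sum {N K : ℕ} (φ : Fin N → Fin K ⊕ Unit) (p : Fin N → ℤ) (l : Fin K) :
    ∑ t, ((sub φ (fun _ => l) t : Fin K) : ℤ) * p t =
      (l : ℤ) * (∑ t, if φ t = Sum.inr () then p t else 0) +
      ∑ t, Sum.elim (fun i : Fin K => (i : ℤ) * p t) (fun _ => 0) (φ t) := by
  rw [Finset.mul_sum, ← Finset.sum_add_distrib]
  refine Finset.sum_congr rfl fun t _ => ?_
  unfold sub
  cases φ t <;> simp

lemma inter_eq {Y : Type} (T : Equiv.Perm Y) (d : ℕ) (n : ℤ) (A : Set Y) :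
    (⋂ j ∈ Finset.range (d + 1), zIter T ((j : ℤ) * n) ⁻¹' A) =
      {y | ∀ l : Fin (d + 1), zIter T ((l : ℤ) * n) y ∈ A} := by
  ext y
  simp only [Set.mem_iInter, Finset.mem_range, Set.mem_preimage, Set.mem_setOf_eq]
  exact ⟨fun h l => h l l.2, fun h j hj => h ⟨j, hj⟩⟩

lemma ip_measRec (d : ℕ) (S : Set ℤ) (p : ℕ → ℤ)
    (hS : ∀ F : Finset ℕ, F.Nonempty → ∑ t ∈ F, p t ∈ S) : MeasRecSet d S := by
  intro Y _ _ μ _ T hT A hA h0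
  have hδ : 0 < μ.real A := ENNReal.toReal_pos h0.ne' (measure_ne_top _ _)
  obtain ⟨N, hN⟩ := dhj d (μ.real A / 2) (by linarith)
  have h1 := meas_line (μ := μ) hδ hN
    (fun w => zIter T.toEquiv (∑ t, ((w t : Fin (d + 1)) : ℤ) * p t) ⁻¹' A)
    (fun w => (mp_zIter T hT _).measurable hA)
    (fun w => by
      rw [measureReal_def, measureReal_def, (mp_zIter T hT _).measure_preimage hA.nullMeasurableSet])
  obtain ⟨φ, -, h2⟩ : ∃ φ ∈ (Finset.univ : Finset (Fin N → Fin (d + 1) ⊕ Unit)), 0 < μ.real {y | Proper φ ∧ ∀ l, y ∈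
      (fun w => zIter T.toEquiv (∑ t : Fin N, ((w t : Fin (d + 1)) : ℤ) * p t) ⁻¹' A) (sub φ (fun _ => l))} := by
    by_contra! H
    have := Finset.sum_nonpos H
    linarith
  have hφ : Proper φ := by
    by_contra hφ
    simp [hφ] at h2
  simp only [hφ, true_and, Set.mem_preimage] at h2
  refine ⟨∑ t : Fin N, if φ t = Sum.inr () then p t else 0, ?_, ?_⟩
  · have := hS ((Finset.univ.filter fun t => φ t = Sum.inr ()).map Fin.valEmbedding) (by
      obtain ⟨t, ht⟩ := hφ ()
      exact ⟨t, Finset.mem_map.2 ⟨t, by simp [ht], rfl⟩⟩)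
    rw [Finset.sum_map, Finset.sum_filter] at this
    exact this
  · rw [inter_eq, ← (meas_shift T hT hA _ _ _ (line_sum φ (fun t => p t))).2]
    exact (ENNReal.toReal_pos_iff.1 h2).1

lemma pattern_measRec (d : ℕ) (S : Set ℤ)
    (h : ∀ (E : Type) [Fintype E], ∃ r : E → Fin (d + 1) → ℤ, ∀ ε : E → Finset (Fin (d + 1)),
      (∃! e, ε e = {0}) → ∑ e, ∑ i ∈ ε e, r e i ∈ S) : MeasRecSet d S := by
  intro Y _ _ μ _ T hT A hA h0
  have hδ : 0 < μ.real A := ENNReal.toReal_pos h0.ne' (measure_ne_top _ _)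
  set δ := μ.real A with hδdef
  obtain ⟨N, hN⟩ := dhj d (δ / 2) (by linarith)
  have hN1 : 1 ≤ N := by
    obtain ⟨φ, hφ, -⟩ := hN Set.univ (by
      have : ind (Set.univ : Set (Fin N → Fin (d + 1))) = fun _ => 1 := by funext; simp [ind]
      rw [this, av_const]
      have : δ ≤ 1 := measureReal_le_one
      linarith)
    obtain ⟨t, -⟩ := hφ ()
    exact t.pos
  set θ : ℝ := δ / 2 / Fintype.card (Fin N → Fin (d + 1) ⊕ Unit) with hθdef
  have hcard : 0 < (Fintype.card (Fin N → Fin (d + 1) ⊕ Unit) : ℝ) := by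
    exact_mod_cast Fintype.card_pos
  have hθ : 0 < θ := by positivity
  obtain ⟨M, hM1, τ, hτ⟩ := coloring d N hN1 (θ / 2) (by positivity)
  haveI : NeZero M := ⟨by omega⟩
  obtain ⟨r, hr⟩ := h (Fin (d + 1) → Fin M)
  let P : Fin (d + 1) → (Fin (d + 1) → Fin M) → Fin M → Prop :=
    fun i e b => if i = 0 then e i = b else e i ≠ b
  let s : Fin N → Fin (d + 1) → Fin M → ℤ := fun t i b =>
    ∑ e, if τ e = t ∧ P i e b then r e i else 0
  let p : (Fin (d + 1) → Fin M) → Fin N → ℤ := fun a t => ∑ i, s t i (a i)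
  let n : (Fin N → Fin (d + 1) ⊕ Unit) → (Fin (d + 1) → Fin M) → ℤ := fun φ a =>
    ∑ t, if φ t = Sum.inr () then p a t else 0
  let R : ℤ → Set Y := fun n => {y | ∀ l : Fin (d + 1), zIter T.toEquiv ((l : ℤ) * n) y ∈ A}
  have h1 : ∀ a, δ / 2 ≤ ∑ φ : Fin N → Fin (d + 1) ⊕ Unit,
      if Proper φ then μ.real (R (n φ a)) else 0 := by
    intro a
    have h1 := meas_line (μ := μ) hδ hN
      (fun w => zIter T.toEquiv (∑ t, ((w t : Fin (d + 1)) : ℤ) * p a t) ⁻¹' A)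
      (fun w => (mp_zIter T hT _).measurable hA)
      (fun w => by
        rw [hδdef, measureReal_def, measureReal_def,
          (mp_zIter T hT _).measure_preimage hA.nullMeasurableSet])
    refine h1.trans (le_of_eq (Finset.sum_congr rfl fun φ _ => ?_))
    split_ifs with hφ
    · simp only [hφ, true_and, Set.mem_preimage]
      rw [measureReal_def, (meas_shift T hT hA _ _ _ (line_sum φ (p a))).2]
      rfl
    · simp [hφ]
  obtain ⟨φ, -, h2⟩ : ∃ φ ∈ (Finset.univ : Finset (Fin N → Fin (d + 1) ⊕ Unit)),
      θ ≤ av fun a => if Proper φ then μ.real (R (n φ a)) else 0 := by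
    by_contra! H
    have h3 := Finset.sum_lt_sum_of_nonempty Finset.univ_nonempty H
    rw [← av_finsum, Finset.sum_const, Finset.card_univ, nsmul_eq_mul, hθdef,
      mul_div_cancel₀ _ hcard.ne'] at h3
    have h4 : δ / 2 ≤ _ := le_trans (le_of_eq (av_const (δ / 2)).symm) (av_mono h1)
    exact absurd h3 (not_lt.2 h4)
  have hφ : Proper φ := by
    by_contra hφ
    simp only [hφ, if_false, av_const] at h2
    linarith
  simp only [hφ, if_true] at h2
  let L : Fin (d + 1) → (Fin (d + 1) → Fin M) → ℤ := fun l a =>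
    ∑ t, if φ t = Sum.inr () then ∑ i : Fin (d + 1), ((l : ℤ) - i) * s t i (a i) else 0
  let D : (Fin (d + 1) → Fin M) → ℤ := fun a =>
    ∑ t, if φ t = Sum.inr () then ∑ i : Fin (d + 1), (-(i : ℤ)) * s t i (a i) else 0
  have hL : ∀ a l, L l a = (l : ℤ) * n φ a + D a := by
    intro a l
    simp only [L, n, D, p]
    rw [Finset.mul_sum, ← Finset.sum_add_distrib]
    refine Finset.sum_congr rfl fun t _ => ?_
    split_ifs
    · rw [Finset.mul_sum, ← Finset.sum_add_distrib]
      refine Finset.sum_congr rfl fun i _ => ?_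
      ring
    · simp
  have hms := fun a => meas_shift T hT hA (n φ a) (D a) (fun l => L l a) (hL a)
  have h3 : (fun a => μ.real (R (n φ a))) =
      fun a => μ.real {y | ∀ l, zIter T.toEquiv (L l a) y ∈ A} := by
    funext a
    simp only [measureReal_def, (hms a).2, R]
  rw [h3, ← integral_av (fun a => (hms a).1)] at h2
  obtain ⟨t1, ht1⟩ := hφ ()
  obtain ⟨a, hat, ha⟩ : ∃ a, τ a = t1 ∧ μ (R (n φ a)) ≠ 0 := by
    by_contra! H
    have hae : ∀ᵐ y ∂μ, ∀ a, τ a = t1 → ¬ ∀ l, zIter T.toEquiv (L l a) y ∈ A := by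
      rw [ae_all_iff]
      intro a
      by_cases hat : τ a = t1
      · have := H a hat
        rw [← (hms a).2] at this
        filter_upwards [measure_eq_zero_iff_ae_notMem.1 this] with y hy _
        exact hy
      · exact ae_of_all _ fun y h => absurd h hat
    have hle : ∫ y, (av fun a => ind {y | ∀ l, zIter T.toEquiv (L l a) y ∈ A} y) ∂μ ≤
        ∫ y, (θ / 2) ∂μ := by
      apply integral_mono_ae (integrable_av fun a => (hms a).1) (integrable_const _)
      filter_upwards [hae] with y hy
      by_contra hlt
      obtain ⟨a, h5, h6⟩ := hτ (fun l a => zIter T.toEquiv (L l a) y ∈ A) (by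
        intro l a a' haa h5
        have : L l a = L l a' := by
          refine Finset.sum_congr rfl fun t _ => ?_
          congr 1
          refine Finset.sum_congr rfl fun i _ => ?_
          by_cases hi : i = l
          · subst hi; simp
          · rw [haa i hi]
        rwa [← this]) (not_le.1 hlt).le t1
      exact hy a h5 h6
    rw [integral_const] at hle
    simp at hle
    linarith
  refine ⟨n φ a, ?_, ?_⟩
  · let ε : (Fin (d + 1) → Fin M) → Finset (Fin (d + 1)) := fun e =>
      Finset.univ.filter fun i => φ (τ e) = Sum.inr () ∧ P i e (a i)
    have h4 := hr ε ⟨a, by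
      simp only [ε]
      ext i
      simp only [Finset.mem_filter, Finset.mem_univ, true_and, Finset.mem_singleton, hat, ht1, P]
      by_cases hi : i = 0 <;> simp [hi], by
      intro e he
      have h0 : (0 : Fin (d + 1)) ∈ ε e := by rw [he]; simp
      simp only [ε, Finset.mem_filter, Finset.mem_univ, true_and, P, if_true] at h0
      funext i
      by_cases hi : i = 0
      · rw [hi]; exact h0.2
      · by_contra hne
        have : i ∈ ε e := by
          simp only [ε, Finset.mem_filter, Finset.mem_univ, true_and, P, hi, if_false]
          exact ⟨h0.1, hne⟩
        rw [he] at this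
        exact hi (Finset.mem_singleton.1 this)⟩
    convert h4 using 1
    simp only [n, p, s, ε]
    have e1 : ∀ t, (if φ t = Sum.inr () then ∑ i, ∑ e, (if τ e = t ∧ P i e (a i) then r e i else 0) else 0) =
        ∑ e, ∑ i, if τ e = t then (if φ (τ e) = Sum.inr () ∧ P i e (a i) then r e i else 0) else 0 := by
      intro t
      rw [Finset.sum_comm]
      rw [Finset.ite_sum_zero]
      refine Finset.sum_congr rfl fun e _ => ?_
      rw [Finset.ite_sum_zero]
      refine Finset.sum_congr rfl fun i _ => ?_
      by_cases h1 : τ e = t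
      · subst h1
        by_cases h2 : φ (τ e) = Sum.inr () <;> simp [h2]
      · simp [h1]
    simp_rw [e1]
    rw [Finset.sum_comm]
    refine Finset.sum_congr rfl fun e _ => ?_
    rw [Finset.sum_comm, Finset.sum_filter]
    refine Finset.sum_congr rfl fun i _ => ?_
    simp
  · rw [inter_eq]
    exact pos_iff_ne_zero.2 ha

end DHJ


end

section

open scoped Classical
open MeasureTheory Filter Topology

namespace DHJ

attribute [local instance] Ultrafilter.add Ultrafilter.addSemigroup

lemma hIter_add {X : Type*} [TopologicalSpace X] (T : X ≃ₜ X) (m n : ℤ) (x : X) :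
    hIter T (m + n) x = hIter T m (hIter T n x) := zIter_add _ _ _ _

lemma hIter_zero {X : Type*} [TopologicalSpace X] (T : X ≃ₜ X) (x : X) : hIter T 0 x = x :=
  zIter_zero _ _

lemma hIter_one {X : Type*} [TopologicalSpace X] (T : X ≃ₜ X) (x : X) : hIter T 1 x = T x :=
  zIter_one _ _

lemma continuous_hIter {X : Type*} [TopologicalSpace X] (T : X ≃ₜ X) (n : ℤ) :
    Continuous (hIter T n) := by
  induction n using Int.induction_on with
  | zero =>
    have : hIter T 0 = id := funext fun x => hIter_zero _ x
    rw [this]; exact continuous_id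
  | succ n ih =>
    have : hIter T (n + 1) = T ∘ hIter T n := by
      funext x
      rw [add_comm, hIter_add, hIter_one]; rfl
    rw [this]; exact T.continuous.comp ih
  | pred n ih =>
    have : hIter T (-n - 1) = T.symm ∘ hIter T (-n) := by
      funext x
      apply T.injective
      have h := hIter_add T 1 (-n - 1) x
      rw [hIter_one, show (1 + (-(n:ℤ) - 1)) = -n by ring] at h
      simp only [Function.comp_apply, Homeomorph.apply_symm_apply]
      exact h.symm
    rw [this]; exact T.symm.continuous.comp ih

lemma exists_ultra {ι Z : Type*} [PseudoMetricSpace Z] (f : ι → Z) (z : Z)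
    (h : ∀ ε > 0, ∃ i, dist (f i) z < ε) : ∃ p : Ultrafilter ι, Tendsto f p (𝓝 z) := by
  have : NeBot (comap f (𝓝 z)) := by
    rw [comap_neBot_iff]
    intro t ht
    obtain ⟨ε, h0, h1⟩ := Metric.mem_nhds_iff.1 ht
    obtain ⟨i, hi⟩ := h ε h0
    exact ⟨i, h1 hi⟩
  refine ⟨Ultrafilter.of (comap f (𝓝 z)), ?_⟩
  exact tendsto_comap.mono_left (Ultrafilter.of_le _)

lemma exists_lim {ι Z : Type*} [TopologicalSpace Z] [CompactSpace Z] (f : ι → Z) (p : Ultrafilter ι) :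
    ∃ z, Tendsto f p (𝓝 z) := by
  obtain ⟨z, -, hz⟩ := isCompact_univ.ultrafilter_le_nhds (p.map f) (by simp)
  exact ⟨z, hz⟩

lemma idem_in {G : Type} [AddCommGroup G] (J : Set (Ultrafilter G)) (h0 : J.Nonempty) (hc : IsClosed J)
    (ha : ∀ p ∈ J, ∀ q ∈ J, p + q ∈ J) : ∃ p ∈ J, p + p = p :=
  exists_idempotent_in_compact_add_subsemigroup (fun r => Ultrafilter.continuous_add_left r) J h0
    hc.isCompact ha

section
variable {X : Type} [MetricSpace X] [CompactSpace X] (T : X ≃ₜ X)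

def HIP (x : X) : Prop := ∀ p : Ultrafilter ℤ, p + p = p → Tendsto (fun n => hIter T n x) p (𝓝 x)

lemma tends_add {x y z : X} {p q : Ultrafilter ℤ} (h1 : Tendsto (fun n => hIter T n x) q (𝓝 y))
    (h2 : Tendsto (fun n => hIter T n y) p (𝓝 z)) :
    Tendsto (fun n => hIter T n x) ((p + q : Ultrafilter ℤ) : Filter ℤ) (𝓝 z) := by
  rw [tendsto_nhds]
  intro V hV hz
  have : ∀ᶠ k in ((p + q : Ultrafilter ℤ) : Filter ℤ), hIter T k x ∈ V := by
    rw [Ultrafilter.eventually_add]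
    filter_upwards [h2.eventually (hV.mem_nhds hz)] with m hm
    have := ((continuous_hIter T m).tendsto y).comp h1
    filter_upwards [this.eventually (hV.mem_nhds hm)] with k hk
    rw [hIter_add]; exact hk
  exact this

lemma closed_tends {f : ℤ → X} {z : X} : IsClosed {p : Ultrafilter ℤ | Tendsto f p (𝓝 z)} := by
  have : {p : Ultrafilter ℤ | Tendsto f p (𝓝 z)} = ⋂ V ∈ 𝓝 z, {p : Ultrafilter ℤ | f ⁻¹' V ∈ p} := by
    ext p
    simp only [Set.mem_setOf_eq, Set.mem_iInter]
    rfl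
  rw [this]
  exact isClosed_biInter fun V _ => ultrafilter_isClosed_basic _

lemma hip_of_aa {x : X} {d : ℕ} (h : ∀ y : X, RPd T d x y → y = x) : HIP T x := by
  intro p hp
  obtain ⟨y, hy⟩ := exists_lim (fun n => hIter T n x) p
  obtain ⟨z, hz⟩ := exists_lim (fun n => hIter T n y) p
  have hzy : z = y := by
    have := tends_add T hy hz
    rw [hp] at this
    exact tendsto_nhds_unique this hy
  subst hzy
  have : z = x := by
    apply h
    intro δ hδ
    have hA : ∀ᶠ n in (p : Filter ℤ), dist (hIter T n x) z < δ / 2 ∧ dist (hIter T n z) z < δ / 2 :=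
      (hy.eventually (Metric.ball_mem_nhds _ (half_pos hδ))).and
        (hz.eventually (Metric.ball_mem_nhds _ (half_pos hδ)))
    obtain ⟨a, ha⟩ := Hindman.exists_FS_of_large p hp _ hA
    refine ⟨x, z, fun i => a.get i, by simpa using hδ, by simpa using hδ, fun ε hε => ?_⟩
    have h1 := Hindman.FS.finsetSum a (ε.map Fin.valEmbedding) (by simpa using hε)
    rw [Finset.sum_map] at h1
    have h2 := ha h1
    exact lt_of_le_of_lt (dist_triangle_right _ _ z) (lt_of_lt_of_eq (add_lt_add h2.1 h2.2) (add_halves δ))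
  rw [← this] at hy ⊢
  exact hy

lemma hip_of_rec {x : X} {d : ℕ} (h : ∀ V : Set X, IsOpen V → x ∈ V →
        ∀ S : Set ℤ, MeasRecSet d S → (Nset T x V ∩ S).Nonempty) : HIP T x := by
  intro p hp
  rw [tendsto_nhds]
  intro V hV hx
  by_contra hn
  have hn' : ((fun n => hIter T n x) ⁻¹' V)ᶜ ∈ p := Ultrafilter.compl_mem_iff_notMem.2 hn
  obtain ⟨a, ha⟩ := Hindman.exists_FS_of_large p hp _ hn'
  obtain ⟨n, h1, h2⟩ := h V hV hx (((fun n => hIter T n x) ⁻¹' V)ᶜ) (ip_measRec d _ (fun i => a.get i)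
    fun F hF => ha (Hindman.FS.finsetSum a F hF))
  exact h2 h1

lemma ucF (F : Finset ℤ) {ε : ℝ} (hε : 0 < ε) : ∃ δ > 0, ∀ u w : X, dist u w < δ →
    ∀ f ∈ F, dist (hIter T f u) (hIter T f w) < ε := by
  induction F using Finset.induction_on with
  | empty => exact ⟨1, one_pos, by simp⟩
  | insert a s ha ih =>
    obtain ⟨δ, h0, h1⟩ := ih
    obtain ⟨δ', h0', h1'⟩ := Metric.uniformContinuous_iff.1
      (CompactSpace.uniformContinuous_of_continuous (continuous_hIter T a)) ε hε
    refine ⟨min δ δ', lt_min h0 h0', fun u w h f hf => ?_⟩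
    rcases Finset.mem_insert.1 hf with rfl | hf
    · exact h1' (lt_of_lt_of_le h (min_le_right _ _))
    · exact h1 u w (lt_of_lt_of_le h (min_le_left _ _)) f hf

lemma ret {x : X} (hx : HIP T x) {G I : Type} [AddCommGroup G] [Finite I] (φ : I → G →+ ℤ) (ζ : I → X)
    (hζ : ∀ ε > 0, ∃ g, ∀ v, dist (hIter T (φ v g) x) (ζ v) < ε) {ε : ℝ} (hε : 0 < ε) :
    ∃ g, ∀ v, dist (hIter T (φ v g) (ζ v)) x < ε := by
  letI := Fintype.ofFinite I
  let A : Set G := {g | ∀ v, dist (hIter T (φ v g) x) x < ε / 2}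
  have hsyn : ∃ F : Finset G, ∀ g, ∃ f ∈ F, g + f ∈ A := by
    by_contra! H
    let J : Set (Ultrafilter G) := {p | ∀ f, {g | g + f ∉ A} ∈ p}
    obtain ⟨p, hpJ, hp⟩ := idem_in J (by
      obtain ⟨p, hp⟩ := Ultrafilter.exists_ultrafilter_of_finite_inter_nonempty
        (Set.range fun f : G => {g | g + f ∉ A}) (by
          intro S hS
          choose! f hf using hS
          obtain ⟨g, hg⟩ := H (S.image f)
          refine ⟨g, fun s hs => ?_⟩
          have := hf hs
          rw [← this]
          exact hg _ (Finset.mem_image_of_mem _ hs))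
      exact ⟨p, fun f => hp ⟨f, rfl⟩⟩) (by
      have : J = ⋂ f, {p : Ultrafilter G | {g | g + f ∉ A} ∈ p} := by ext; simp [J]
      rw [this]
      exact isClosed_iInter fun f => ultrafilter_isClosed_basic _) (by
      intro p hp q hq f
      have : ∀ᶠ k in ((p + q : Ultrafilter G) : Filter G), k + f ∉ A := by
        rw [Ultrafilter.eventually_add]
        refine Eventually.of_forall fun m => ?_
        filter_upwards [hq (m + f)] with k hk
        rwa [show m + k + f = k + (m + f) by abel]
      exact this)
    have h1 : ∀ᶠ g in (p : Filter G), ∀ v, dist (hIter T (φ v g) x) x < ε / 2 := by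
      rw [eventually_all]
      intro v
      have h2 : p.map (φ v) + p.map (φ v) = p.map (φ v) := by
        conv_rhs => rw [← hp]
        apply Ultrafilter.coe_injective
        apply Filter.ext'
        intro P
        rw [Ultrafilter.eventually_add, Ultrafilter.coe_map, Ultrafilter.coe_map, eventually_map, eventually_map,
          Ultrafilter.eventually_add]
        simp only [eventually_map, map_add]
      exact (hx _ h2).eventually (Metric.ball_mem_nhds _ (half_pos hε))
    have h3 := hpJ 0
    simp only [add_zero] at h3
    obtain ⟨g, h4, h5⟩ := (h1.and h3).exists
    exact h5 h4
  obtain ⟨F, hF⟩ := hsyn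
  obtain ⟨δ, hδ, h1⟩ := ucF T ((Finset.univ ×ˢ F).image fun p : I × G => φ p.1 p.2) (half_pos hε)
  obtain ⟨g, hg⟩ := hζ δ hδ
  obtain ⟨f, hf, hgf⟩ := hF g
  refine ⟨f, fun v => ?_⟩
  have h2 := h1 _ _ (hg v) (φ v f) (Finset.mem_image.2 ⟨(v, f), by simp [hf], rfl⟩)
  rw [← hIter_add, ← map_add, add_comm f g, dist_comm] at h2
  have h3 := dist_triangle (hIter T (φ v f) (ζ v)) (hIter T (φ v (g + f)) x) x
  have := hgf v
  linarith

lemma near (hmin : MinimalTDS T) (x y : X) {ε : ℝ} (hε : 0 < ε) : ∃ n, dist (hIter T n x) y < ε := by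
  obtain ⟨z, h2, ⟨n, hn⟩⟩ := Metric.dense_iff.1 (hmin x) y ε hε
  refine ⟨n, ?_⟩
  rw [← hn] at h2
  exact h2

lemma nonprox (hmin : MinimalTDS T) {x y : X} (hx : HIP T x) (hy : y ≠ x) :
    ∃ η > 0, ∀ n, dist (hIter T n x) x < η → η ≤ dist (hIter T n y) x := by
  by_contra! H
  obtain ⟨p0, hp0⟩ := exists_ultra (fun n => (hIter T n x, hIter T n y)) (x, x) (by
    intro ε hε
    obtain ⟨n, h1, h2⟩ := H ε hε
    exact ⟨n, max_lt h1 h2⟩)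
  rw [nhds_prod_eq, tendsto_prod_iff'] at hp0
  obtain ⟨q, hq⟩ := exists_ultra (fun n => hIter T n x) y (by
    intro ε hε
    exact near T hmin x y hε)
  obtain ⟨p, ⟨h1, h2⟩, hp⟩ := idem_in ({p : Ultrafilter ℤ | Tendsto (fun n => hIter T n x) p (𝓝 y)} ∩
      {p : Ultrafilter ℤ | Tendsto (fun n => hIter T n y) p (𝓝 y)})
    ⟨q + p0, tends_add T hp0.1 hq, tends_add T hp0.2 hq⟩ (closed_tends.inter closed_tends) (by
    intro p hp q hq
    exact ⟨tends_add T hq.1 hp.2, tends_add T hq.2 hp.2⟩)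
  exact hy (tendsto_nhds_unique h1 (hx p hp))

end
end DHJ


end

section

open scoped Classical
open MeasureTheory Filter Topology

namespace DHJ
section
variable {X : Type} [MetricSpace X] [CompactSpace X] (T : X ≃ₜ X)

/-- the sum over a face, as a homomorphism -/
def dotH {d : ℕ} (e : Finset (Fin d)) : (Fin d → ℤ) →+ ℤ where
  toFun g := ∑ i ∈ e, g i
  map_zero' := by simp
  map_add' a b := by simp [Finset.sum_add_distrib]

lemma dotH_apply {d : ℕ} (e : Finset (Fin d)) (g : Fin d → ℤ) : dotH e g = ∑ i ∈ e, g i := rfl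

lemma dotH_empty {d : ℕ} (g : Fin d → ℤ) : dotH ∅ g = 0 := by simp [dotH_apply]

def InK (x : X) {d : ℕ} (z w u : Finset (Fin d) → X) : Prop :=
  ∀ δ > 0, ∃ (c1 c2 : ℤ) (m : Fin d → ℤ), ∀ e,
    dist (hIter T (dotH e m) x) (z e) < δ ∧ dist (hIter T (c1 + dotH e m) x) (w e) < δ ∧
    dist (hIter T (c2 + dotH e m) x) (u e) < δ

lemma cube0 (hmin : MinimalTDS T) {x y : X} {d : ℕ} (h : RPd T d x y) {δ : ℝ} (hδ : 0 < δ) :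
    ∃ (c1 c2 : ℤ) (m : Fin d → ℤ), dist (hIter T c1 x) x < δ ∧ dist (hIter T c2 x) y < δ ∧
      ∀ e : Finset (Fin d), e.Nonempty →
        dist (hIter T (c1 + dotH e m) x) (hIter T (c2 + dotH e m) x) < δ := by
  obtain ⟨x', y', m, h1, h2, h3⟩ := h (δ / 3) (by positivity)
  obtain ⟨δ', hδ', h4⟩ := ucF T (Finset.univ.image fun e => dotH e m) (show 0 < δ / 3 by positivity)
  obtain ⟨c1, hc1⟩ := near T hmin x x' (lt_min hδ' (show 0 < δ / 3 by positivity))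
  obtain ⟨c2, hc2⟩ := near T hmin x y' (lt_min hδ' (show 0 < δ / 3 by positivity))
  rw [lt_min_iff] at hc1 hc2
  refine ⟨c1, c2, m, ?_, ?_, fun e he => ?_⟩
  · linarith [dist_triangle_right (hIter T c1 x) x x', hc1.2]
  · linarith [dist_triangle_right (hIter T c2 x) y y', hc2.2]
  · have h5 := h4 _ _ hc1.1 (dotH e m) (Finset.mem_image_of_mem _ (Finset.mem_univ _))
    have h6 := h4 _ _ hc2.1 (dotH e m) (Finset.mem_image_of_mem _ (Finset.mem_univ _))
    have h7 := h3 e he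
    rw [← dotH_apply] at h7
    rw [← hIter_add, add_comm] at h5 h6
    rw [dist_comm] at h6
    linarith [dist_triangle4 (hIter T (c1 + dotH e m) x) (hIter T (dotH e m) x')
      (hIter T (dotH e m) y') (hIter T (c2 + dotH e m) x)]

lemma cube1 (hmin : MinimalTDS T) {x y : X} {d : ℕ} (h : RPd T d x y) :
    ∃ z w : Finset (Fin d) → X, w ∅ = x ∧ InK T x z w (Function.update w ∅ y) := by
  let f : ℤ × ℤ × (Fin d → ℤ) → X × X × (Finset (Fin d) → ℝ) := fun p =>
    (hIter T p.1 x, hIter T p.2.1 x, fun e => if e = ∅ then 0 else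
      dist (hIter T (p.1 + dotH e p.2.2) x) (hIter T (p.2.1 + dotH e p.2.2) x))
  obtain ⟨p, hp⟩ := exists_ultra f (x, y, fun _ => 0) (by
    intro ε hε
    obtain ⟨c1, c2, m, h1, h2, h3⟩ := cube0 T hmin h hε
    refine ⟨(c1, c2, m), max_lt h1 (max_lt h2 ?_)⟩
    rw [dist_pi_lt_iff hε]
    intro e
    by_cases he : e = ∅
    · simp [f, he, hε]
    · have := h3 e (Finset.nonempty_iff_ne_empty.2 he)
      simp only [f, he, if_false, Real.dist_eq, sub_zero, abs_of_nonneg dist_nonneg]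
      exact this)
  rw [nhds_prod_eq, tendsto_prod_iff', nhds_prod_eq, tendsto_prod_iff', tendsto_pi_nhds] at hp
  obtain ⟨hp1, hp2, hp3⟩ := hp
  choose z hz using fun e => exists_lim (fun p : ℤ × ℤ × (Fin d → ℤ) => hIter T (dotH e p.2.2) x) p
  choose w hw using fun e => exists_lim (fun p : ℤ × ℤ × (Fin d → ℤ) => hIter T (p.1 + dotH e p.2.2) x) p
  refine ⟨z, w, ?_, ?_⟩
  · have := hw ∅
    simp only [dotH_empty, add_zero] at this
    exact tendsto_nhds_unique this hp1
  · have hu : ∀ e, Tendsto (fun p : ℤ × ℤ × (Fin d → ℤ) => hIter T (p.2.1 + dotH e p.2.2) x) p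
        (𝓝 (Function.update w ∅ y e)) := by
      intro e
      by_cases he : e = ∅
      · subst he
        simp only [dotH_empty, add_zero, Function.update_self]
        exact hp2
      · rw [Function.update_of_ne he]
        have := hp3 e
        simp only [f, he, if_false] at this
        exact (tendsto_iff_of_dist this).1 (hw e)
    intro δ hδ
    have : ∀ᶠ q in (p : Filter (ℤ × ℤ × (Fin d → ℤ))), ∀ e, dist (hIter T (dotH e q.2.2) x) (z e) < δ ∧
        dist (hIter T (q.1 + dotH e q.2.2) x) (w e) < δ ∧
        dist (hIter T (q.2.1 + dotH e q.2.2) x) (Function.update w ∅ y e) < δ := by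
      rw [eventually_all]
      intro e
      exact ((hz e).eventually (Metric.ball_mem_nhds _ hδ)).and
        (((hw e).eventually (Metric.ball_mem_nhds _ hδ)).and
        ((hu e).eventually (Metric.ball_mem_nhds _ hδ)))
    obtain ⟨q, hq⟩ := this.exists
    exact ⟨q.1, q.2.1, q.2.2, hq⟩

lemma cube2 {x y : X} (hx : HIP T x) {d : ℕ} {z w : Finset (Fin d) → X} (hw : w ∅ = x)
    (h : InK T x z w (Function.update w ∅ y)) :
    ∃ w' : Finset (Fin d) → X, w' ∅ = x ∧ InK T x (fun _ => x) w' (Function.update w' ∅ y) := by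
  obtain ⟨p, hp⟩ := exists_ultra (fun (g : Fin d → ℤ) (e : Finset (Fin d)) => hIter T (dotH e g) (z e))
    (fun _ => x) (by
      intro ε hε
      obtain ⟨g, hg⟩ := ret T hx (fun e : Finset (Fin d) => dotH e) z (by
        intro ε hε
        obtain ⟨c1, c2, m, hm⟩ := h ε hε
        exact ⟨m, fun e => (hm e).1⟩) hε
      exact ⟨g, (dist_pi_lt_iff hε).2 hg⟩)
  rw [tendsto_pi_nhds] at hp
  choose w' hw' using fun e => exists_lim (fun g : Fin d → ℤ => hIter T (dotH e g) (w e)) p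
  refine ⟨w', ?_, ?_⟩
  · have := hw' ∅
    simp only [dotH_empty, hIter_zero] at this
    rw [← hw]
    exact tendsto_nhds_unique this tendsto_const_nhds
  have hu : ∀ e, Tendsto (fun g : Fin d → ℤ => hIter T (dotH e g) (Function.update w ∅ y e)) p
        (𝓝 (Function.update w' ∅ y e)) := by
    intro e
    by_cases he : e = ∅
    · subst he
      simp only [dotH_empty, hIter_zero, Function.update_self]
      exact tendsto_const_nhds
    · rw [Function.update_of_ne he, Function.update_of_ne he]
      exact hw' e
  intro δ hδ
  have : ∀ᶠ g in (p : Filter (Fin d → ℤ)), ∀ e, dist (hIter T (dotH e g) (z e)) x < δ / 2 ∧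
      dist (hIter T (dotH e g) (w e)) (w' e) < δ / 2 ∧
      dist (hIter T (dotH e g) (Function.update w ∅ y e)) (Function.update w' ∅ y e) < δ / 2 := by
    rw [eventually_all]
    intro e
    exact ((hp e).eventually (Metric.ball_mem_nhds _ (half_pos hδ))).and
        (((hw' e).eventually (Metric.ball_mem_nhds _ (half_pos hδ))).and
        ((hu e).eventually (Metric.ball_mem_nhds _ (half_pos hδ))))
  obtain ⟨g, hg⟩ := this.exists
  obtain ⟨δ', hδ', h4⟩ := ucF T (Finset.univ.image fun e => dotH e g) (half_pos hδ)
  obtain ⟨c1, c2, m, hm⟩ := h δ' hδ'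
  refine ⟨c1, c2, g + m, fun e => ?_⟩
  have hmem : dotH e g ∈ Finset.univ.image fun e => dotH e g :=
    Finset.mem_image_of_mem _ (Finset.mem_univ _)
  obtain ⟨m1, m2, m3⟩ := hm e
  obtain ⟨g1, g2, g3⟩ := hg e
  have n1 := h4 _ _ m1 _ hmem
  have n2 := h4 _ _ m2 _ hmem
  have n3 := h4 _ _ m3 _ hmem
  rw [← hIter_add] at n1 n2 n3
  rw [map_add, add_left_comm, add_left_comm c2]
  refine ⟨?_, ?_, ?_⟩
  · exact (dist_triangle _ _ _).trans_lt (by linarith)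
  · exact (dist_triangle _ _ _).trans_lt (by linarith)
  · exact (dist_triangle _ _ _).trans_lt (by linarith)

lemma cube (hmin : MinimalTDS T) {x y : X} (hx : HIP T x) {d : ℕ} (h : RPd T d x y) (hy : y ≠ x) :
    ∃ y0, y0 ≠ x ∧ ∀ δ > 0, ∃ (c : ℤ) (m : Fin d → ℤ),
      (∀ e, dist (hIter T (dotH e m) x) x < δ) ∧
      (∀ e : Finset (Fin d), e.Nonempty → dist (hIter T (c + dotH e m) x) x < δ) ∧
      dist (hIter T c x) y0 < δ := by
  obtain ⟨z, w0, hw0, hK0⟩ := cube1 T hmin h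
  obtain ⟨w, hw, hK⟩ := cube2 T hx hw0 hK0
  obtain ⟨η, hη, hnp⟩ := nonprox T hmin hx hy
  let φ : Finset (Fin d) ⊕ Finset (Fin d) → (Fin d → ℤ) × ℤ →+ ℤ := Sum.elim
    (fun e => (dotH e).comp (AddMonoidHom.fst _ _))
    (fun e => AddMonoidHom.snd _ _ + (dotH e).comp (AddMonoidHom.fst _ _))
  let ζ : Finset (Fin d) ⊕ Finset (Fin d) → X := Sum.elim (fun _ => x) w
  obtain ⟨p, hp⟩ := exists_ultra (fun g v => hIter T (φ v g) (ζ v)) (fun _ => x) (by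
      intro ε hε
      obtain ⟨g, hg⟩ := ret T hx φ ζ (by
        intro ε hε
        obtain ⟨c1, c2, m, hm⟩ := hK ε hε
        refine ⟨(m, c1), ?_⟩
        rintro (e | e)
        · exact (hm e).1
        · exact (hm e).2.1) hε
      exact ⟨g, (dist_pi_lt_iff hε).2 hg⟩)
  rw [tendsto_pi_nhds] at hp
  obtain ⟨y0, hy0⟩ := exists_lim (fun g : (Fin d → ℤ) × ℤ => hIter T g.2 y) p
  have hp1 : ∀ e, Tendsto (fun g : (Fin d → ℤ) × ℤ => hIter T (dotH e g.1) x) p (𝓝 x) := fun e => hp (Sum.inl e)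
  have hp2 : ∀ e, Tendsto (fun g : (Fin d → ℤ) × ℤ => hIter T (g.2 + dotH e g.1) (w e)) p (𝓝 x) :=
    fun e => hp (Sum.inr e)
  have hp3 : Tendsto (fun g : (Fin d → ℤ) × ℤ => hIter T g.2 x) p (𝓝 x) := by
    have := hp2 ∅
    simpa only [dotH_empty, add_zero, hw] using this
  refine ⟨y0, ?_, ?_⟩
  · rintro rfl
    have h1 := (hp3.eventually (Metric.ball_mem_nhds _ hη)).and (hy0.eventually (Metric.ball_mem_nhds _ hη))
    obtain ⟨g, h2, h3⟩ := h1.exists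
    exact absurd (hnp _ h2) (not_le.2 h3)
  intro δ hδ
  have : ∀ᶠ g in (p : Filter ((Fin d → ℤ) × ℤ)), dist (hIter T g.2 y) y0 < δ / 2 ∧
      ∀ e, dist (hIter T (dotH e g.1) x) x < δ / 2 ∧
      dist (hIter T (g.2 + dotH e g.1) (w e)) x < δ / 2 := by
    refine (hy0.eventually (Metric.ball_mem_nhds _ (half_pos hδ))).and ?_
    rw [eventually_all]
    intro e
    exact ((hp1 e).eventually (Metric.ball_mem_nhds _ (half_pos hδ))).and
        ((hp2 e).eventually (Metric.ball_mem_nhds _ (half_pos hδ)))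
  obtain ⟨⟨g, k⟩, hgy, hg⟩ := this.exists
  simp only at hgy hg
  obtain ⟨δ', hδ', h4⟩ := ucF T (insert k ((Finset.univ.image fun e => dotH e g) ∪
    Finset.univ.image fun e => k + dotH e g)) (half_pos hδ)
  obtain ⟨c1, c2, m, hm⟩ := hK δ' hδ'
  refine ⟨k + c2, g + m, fun e => ?_, fun e he => ?_, ?_⟩
  · have n1 := h4 _ _ (hm e).1 (dotH e g) (by simp)
    rw [← hIter_add] at n1
    rw [map_add]
    exact (dist_triangle _ _ _).trans_lt (by linarith [(hg e).1])
  · have n1 := h4 _ _ (hm e).2.2 (k + dotH e g) (by simp)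
    rw [← hIter_add, Function.update_of_ne he.ne_empty] at n1
    rw [map_add, add_add_add_comm]
    exact (dist_triangle _ _ _).trans_lt (by linarith [(hg e).2])
  · have n1 := h4 _ _ (hm ∅).2.2 k (by simp)
    rw [← hIter_add, Function.update_self, dotH_empty, add_zero] at n1
    exact (dist_triangle _ _ _).trans_lt (by linarith)

lemma cons_sum {d : ℕ} (c : ℤ) (m : Fin d → ℤ) (F : Finset (Fin (d + 1))) :
    ∑ i ∈ F, (Fin.cons c m : Fin (d + 1) → ℤ) i = (if 0 ∈ F then c else 0) +
      dotH (Finset.univ.filter fun i => Fin.succ i ∈ F) m := by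
  have : ∑ i ∈ F, (Fin.cons c m : Fin (d + 1) → ℤ) i =
      ∑ i, if i ∈ F then (Fin.cons c m : Fin (d + 1) → ℤ) i else 0 := by
    rw [← Finset.sum_filter]
    congr 1
    ext; simp
  rw [this, Fin.sum_univ_succ, dotH_apply, Finset.sum_filter]
  simp

lemma seqlem {x y0 : X} {d : ℕ} {η : ℝ} (hη : 0 < η)
    (hnp : ∀ n, dist (hIter T n x) x < η → η ≤ dist (hIter T n y0) x)
    (hc : ∀ δ > 0, ∃ (c : ℤ) (m : Fin d → ℤ),
      (∀ e, dist (hIter T (dotH e m) x) x < δ) ∧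
      (∀ e : Finset (Fin d), e.Nonempty → dist (hIter T (c + dotH e m) x) x < δ) ∧
      dist (hIter T c x) y0 < δ) (E : Type) [Fintype E] (s : Finset E) :
    ∃ r : E → Fin (d + 1) → ℤ, ∀ ε : E → Finset (Fin (d + 1)),
      ((∀ j ∈ s, ε j ≠ {0}) → dist (hIter T (∑ j ∈ s, ∑ i ∈ ε j, r j i) x) x < η) ∧
      ((∃ j0 ∈ s, ε j0 = {0} ∧ ∀ j ∈ s, ε j = {0} → j = j0) →
        η / 2 < dist (hIter T (∑ j ∈ s, ∑ i ∈ ε j, r j i) x) x) := by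
  induction s using Finset.induction_on with
  | empty => exact ⟨fun _ _ => 0, fun ε => ⟨by simp [hIter_zero, hη], by simp⟩⟩
  | insert j s hj ih =>
    obtain ⟨r, hr⟩ := ih
    have hcont : ∀ (n : ℤ) (y : X), Tendsto (fun u => dist (hIter T n u) x) (𝓝 y) (𝓝 (dist (hIter T n y) x)) :=
      fun n y => ((continuous_hIter T n).dist continuous_const).tendsto y
    have h1 : ∀ᶠ u in 𝓝 x, ∀ ε : E → Finset (Fin (d + 1)),
      ((∀ j ∈ s, ε j ≠ {0}) → dist (hIter T (∑ j ∈ s, ∑ i ∈ ε j, r j i) u) x < η) ∧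
      ((∃ j0 ∈ s, ε j0 = {0} ∧ ∀ j ∈ s, ε j = {0} → j = j0) →
        η / 2 < dist (hIter T (∑ j ∈ s, ∑ i ∈ ε j, r j i) u) x) := by
      rw [eventually_all]
      intro ε
      refine Eventually.and ?_ ?_
      · by_cases h : ∀ j ∈ s, ε j ≠ {0}
        · filter_upwards [(hcont _ x).eventually (gt_mem_nhds ((hr ε).1 h))] with u hu _ using hu
        · exact Eventually.of_forall fun u h' => absurd h' h
      · by_cases h : ∃ j0 ∈ s, ε j0 = {0} ∧ ∀ j ∈ s, ε j = {0} → j = j0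
        · filter_upwards [(hcont _ x).eventually (lt_mem_nhds ((hr ε).2 h))] with u hu _ using hu
        · exact Eventually.of_forall fun u h' => absurd h' h
    have h2 : ∀ᶠ u in 𝓝 y0, ∀ ε : E → Finset (Fin (d + 1)),
      (∀ j ∈ s, ε j ≠ {0}) → η / 2 < dist (hIter T (∑ j ∈ s, ∑ i ∈ ε j, r j i) u) x := by
      rw [eventually_all]
      intro ε
      by_cases h : ∀ j ∈ s, ε j ≠ {0}
      · filter_upwards [(hcont _ y0).eventually (lt_mem_nhds
          (lt_of_lt_of_le (half_lt_self hη) (hnp _ ((hr ε).1 h))))] with u hu _ using hu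
      · exact Eventually.of_forall fun u h' => absurd h' h
    obtain ⟨δ1, hδ1, h1⟩ := Metric.eventually_nhds_iff.1 h1
    obtain ⟨δ2, hδ2, h2⟩ := Metric.eventually_nhds_iff.1 h2
    obtain ⟨c, m, hm1, hm2, hm3⟩ := hc (min δ1 δ2) (lt_min hδ1 hδ2)
    refine ⟨Function.update r j (Fin.cons c m), fun ε => ?_⟩
    have hsum : ∑ k ∈ insert j s, ∑ i ∈ ε k, Function.update r j (Fin.cons c m) k i =
        (∑ k ∈ s, ∑ i ∈ ε k, r k i) + ∑ i ∈ ε j, (Fin.cons c m : Fin (d + 1) → ℤ) i := by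
      rw [Finset.sum_insert hj, Function.update_self, add_comm]
      congr 1
      refine Finset.sum_congr rfl fun k hk => ?_
      rw [Function.update_of_ne]
      rintro rfl
      exact hj hk
    rw [hsum, hIter_add]
    have hgood : ε j ≠ {0} → dist (hIter T (∑ i ∈ ε j, (Fin.cons c m : Fin (d + 1) → ℤ) i) x) x < δ1 := by
      intro hne
      refine lt_of_lt_of_le ?_ (min_le_left δ1 δ2)
      rw [cons_sum]
      by_cases h0 : 0 ∈ ε j
      · rw [if_pos h0]
        apply hm2
        obtain ⟨i, hi, hi0⟩ : ∃ i ∈ ε j, i ≠ 0 := by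
          by_contra! H
          apply hne
          ext i
          simp only [Finset.mem_singleton]
          exact ⟨H i, fun h => h ▸ h0⟩
        obtain ⟨k, rfl⟩ := Fin.exists_succ_eq.2 hi0
        exact ⟨k, by simp [hi]⟩
      · rw [if_neg h0, zero_add]
        exact hm1 _
    refine ⟨fun h => ?_, ?_⟩
    · exact (h1 (hgood (h j (Finset.mem_insert_self _ _))) ε).1 fun k hk => h k (Finset.mem_insert_of_mem hk)
    · rintro ⟨j0, hj0, h0, hu⟩
      by_cases hjj : ε j = {0}
      · have := hu j (Finset.mem_insert_self _ _) hjj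
        subst this
        apply h2
        · rw [hjj, Finset.sum_singleton, Fin.cons_zero]
          exact lt_of_lt_of_le hm3 (min_le_right _ _)
        · intro k hk hk0
          exact hj (hu k (Finset.mem_insert_of_mem hk) hk0 ▸ hk)
      · refine (h1 (hgood hjj) ε).2 ⟨j0, ?_, h0, fun k hk => hu k (Finset.mem_insert_of_mem hk)⟩
        rcases Finset.mem_insert.1 hj0 with rfl | h
        · exact absurd h0 hjj
        · exact h

lemma part21 (hmin : MinimalTDS T) {x : X} {d : ℕ} (h : ∀ V : Set X, IsOpen V → x ∈ V →
        ∀ S : Set ℤ, MeasRecSet d S → (Nset T x V ∩ S).Nonempty) (y : X) (hy : RPd T d x y) : y = x := by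
  by_contra hne
  have hx := hip_of_rec T h
  obtain ⟨y0, hy0, hc⟩ := cube T hmin hx hy hne
  obtain ⟨η, hη, hnp⟩ := nonprox T hmin hx hy0
  obtain ⟨n, h1, h2⟩ := h (Metric.ball x (η / 2)) Metric.isOpen_ball (Metric.mem_ball_self (half_pos hη))
    {n | η / 2 < dist (hIter T n x) x} (pattern_measRec d _ (by
      intro E _
      obtain ⟨r, hr⟩ := seqlem T hη hnp hc E Finset.univ
      refine ⟨r, fun ε hε => (hr ε).2 ?_⟩
      obtain ⟨j0, h1, h2⟩ := hε
      exact ⟨j0, Finset.mem_univ _, h1, fun j _ => h2 j⟩))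
  exact lt_asymm (Metric.mem_ball.1 h1) h2

end
end DHJ


end

section

open scoped Classical
open MeasureTheory Filter Topology

namespace DHJ

lemma exists_inv {X : Type} [MetricSpace X] [CompactSpace X] [MeasurableSpace X] [BorelSpace X]
    (T : X ≃ₜ X) (x : X) :
    ∃ μ : Measure X, IsProbabilityMeasure μ ∧ MeasurePreserving T μ μ := by
  let m : ℕ → Measure X := fun N => ((N + 1 : ℕ) : ENNReal)⁻¹ •
    ∑ n ∈ Finset.range (N + 1), Measure.dirac (T^[n] x)
  have hm : ∀ N, IsProbabilityMeasure (m N) := by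
    intro N
    constructor
    simp only [m, Measure.smul_apply, Measure.coe_finset_sum, Finset.sum_apply, measure_univ,
      Finset.sum_const, Finset.card_range, smul_eq_mul, nsmul_eq_mul, mul_one]
    exact ENNReal.inv_mul_cancel (by simp) (by exact ENNReal.natCast_ne_top _)
  have hint : ∀ N (f : X → ℝ), Continuous f → ∫ y, f y ∂(m N) = ((N + 1 : ℕ) : ℝ)⁻¹ *
      ∑ n ∈ Finset.range (N + 1), f (T^[n] x) := by
    intro N f hf
    simp only [m]
    rw [integral_smul_measure, integral_finset_sum_measure]
    · simp [integral_dirac]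
      left
      exact_mod_cast ENNReal.toReal_natCast (N + 1)
    · intro i _
      exact integrable_dirac (by simp)
  let P : ℕ → ProbabilityMeasure X := fun N => ⟨m N, hm N⟩
  obtain ⟨μ, hμ⟩ := exists_lim P (Ultrafilter.of atTop)
  rw [ProbabilityMeasure.tendsto_iff_forall_integral_tendsto] at hμ
  refine ⟨μ, inferInstance, T.continuous.measurable, ?_⟩
  haveI : IsProbabilityMeasure (Measure.map T (μ : Measure X)) :=
    Measure.isProbabilityMeasure_map T.continuous.measurable.aemeasurable
  apply ext_of_forall_integral_eq_of_IsFiniteMeasure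
  intro f
  rw [integral_map T.continuous.measurable.aemeasurable f.continuous.aestronglyMeasurable]
  let g : BoundedContinuousFunction X ℝ := f.compContinuous ⟨T, T.continuous⟩
  have h1 := hμ f
  have h2 := hμ g
  have h3 : Tendsto (fun N => (∫ y, g y ∂(P N : Measure X)) - ∫ y, f y ∂(P N : Measure X))
      (Ultrafilter.of atTop : Ultrafilter ℕ) (𝓝 0) := by
    refine Tendsto.mono_left ?_ (Ultrafilter.of_le _)
    have : ∀ N, (∫ y, g y ∂(P N : Measure X)) - ∫ y, f y ∂(P N : Measure X) =
        ((N + 1 : ℕ) : ℝ)⁻¹ * (f (T^[N + 1] x) - f x) := by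
      intro N
      simp only [P, ProbabilityMeasure.coe_mk]
      rw [hint N g g.continuous, hint N f f.continuous, ← mul_sub, ← Finset.sum_sub_distrib]
      congr 1
      have := Finset.sum_range_sub (fun n => f (T^[n] x)) (N + 1)
      simp only [Function.iterate_zero, id] at this
      rw [← this]
      refine Finset.sum_congr rfl fun n _ => ?_
      simp [g, Function.iterate_succ_apply']
    simp_rw [this]
    refine squeeze_zero_norm (a := fun N : ℕ => ((N + 1 : ℕ) : ℝ)⁻¹ * (2 * ‖f‖)) (fun N => ?_) ?_
    · rw [norm_mul, Real.norm_of_nonneg (by positivity)]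
      refine mul_le_mul_of_nonneg_left ?_ (by positivity)
      refine (norm_sub_le _ _).trans ?_
      linarith [f.norm_coe_le_norm (T^[N + 1] x), f.norm_coe_le_norm x]
    · have := (tendsto_inv_atTop_nhds_zero_nat (𝕜 := ℝ)).comp (tendsto_add_atTop_nat 1)
      simpa using this.mul_const (2 * ‖f‖)
  have h4 := tendsto_nhds_unique h3 (h2.sub h1)
  exact (sub_eq_zero.1 h4.symm)

lemma top_of_meas {d : ℕ} {S : Set ℤ} (h : MeasRecSet d S) : TopRecSet d S := by
  intro X _ _ T hmin U hU hne
  letI : MeasurableSpace X := borel X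
  haveI : BorelSpace X := ⟨rfl⟩
  obtain ⟨x, hx⟩ := hne
  obtain ⟨μ, hμ, hT⟩ := exists_inv T x
  have hpos : 0 < μ U := by
    by_contra h0
    have h0 : μ U = 0 := by simpa using h0
    have h1 : (⋃ n : ℤ, hIter T n ⁻¹' U) = Set.univ := by
      rw [Set.eq_univ_iff_forall]
      intro y
      obtain ⟨z, h1, ⟨n, rfl⟩⟩ := (hmin y).inter_open_nonempty U hU ⟨x, hx⟩
      exact Set.mem_iUnion.2 ⟨n, h1⟩
    have h2 : μ (⋃ n : ℤ, hIter T n ⁻¹' U) = 0 := by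
      rw [measure_iUnion_null_iff]
      intro n
      rw [← h0]
      exact (mp_zIter T.toMeasurableEquiv hT n).measure_preimage hU.measurableSet.nullMeasurableSet
    rw [h1, measure_univ] at h2
    exact one_ne_zero h2
  obtain ⟨n, hn, h1⟩ := h X μ T.toMeasurableEquiv hT U hU.measurableSet hpos
  exact ⟨n, hn, nonempty_of_measure_ne_zero h1.ne'⟩

end DHJ


end

section

open scoped Classical
open MeasureTheory Filter Topology

namespace DHJ

def ofAct {X : Type} [TopologicalSpace X] (F : ℤ → X → X) (h0 : ∀ y, F 0 y = y)
    (ha : ∀ m n y, F (m + n) y = F m (F n y)) (hc : ∀ n, Continuous (F n)) : X ≃ₜ X where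
  toFun := F 1
  invFun := F (-1)
  left_inv y := by rw [← ha]; exact h0 y
  right_inv y := by rw [← ha]; exact h0 y
  continuous_toFun := hc 1
  continuous_invFun := hc (-1)

lemma hIter_ofAct {X : Type} [TopologicalSpace X] (F : ℤ → X → X) (h0 : ∀ y, F 0 y = y)
    (ha : ∀ m n y, F (m + n) y = F m (F n y)) (hc : ∀ n, Continuous (F n)) (n : ℤ) (y : X) :
    hIter (ofAct F h0 ha hc) n y = F n y := by
  induction n using Int.induction_on with
  | zero => rw [hIter_zero, h0]
  | succ n ih =>
    rw [add_comm, hIter_add, ih, hIter_one, ha]; rfl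
  | pred n ih =>
    apply (ofAct F h0 ha hc).injective
    have h := hIter_add (ofAct F h0 ha hc) 1 (-n - 1) y
    rw [hIter_one, show (1 + (-(n:ℤ) - 1)) = -n by ring, ih] at h
    rw [← h]
    change _ = F 1 _
    rw [← ha]
    congr 1
    ring

lemma tower {d : ℕ} (hd : 1 ≤ d) {S : Set ℤ} (hS : TopRecSet d S) (D : ℤ) (hD : 0 < D) :
    TopRecSet d {m | D * m ∈ S} := by
  intro Y _ _ R hmin U hU hne
  let Z := Set.Ico (0:ℤ) D
  let F : ℤ → Y × Z → Y × Z := fun n p =>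
    (hIter R ((p.2.1 + n) / D) p.1, ⟨(p.2.1 + n) % D, Int.emod_nonneg _ hD.ne', Int.emod_lt_of_pos _ hD⟩)
  have h0 : ∀ p, F 0 p = p := by
    rintro ⟨y, i, hi0, hiD⟩
    simp only [F, add_zero]
    rw [Int.ediv_eq_zero_of_lt hi0 hiD, hIter_zero]
    congr 2
    exact Int.emod_eq_of_lt hi0 hiD
  have ha : ∀ m n p, F (m + n) p = F m (F n p) := by
    rintro m n ⟨y, i, hi0, hiD⟩
    have e : i + (m + n) = ((i + n) % D + m) + D * ((i + n) / D) := by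
      have := Int.emod_add_mul_ediv (i + n) D
      linarith
    simp only [F]
    rw [← hIter_add, e, Int.add_mul_ediv_left _ _ hD.ne']
    congr 2
    exact Int.add_mul_emod_self_left _ _ _
  have hc : ∀ n, Continuous (F n) := by
    intro n
    rw [continuous_iff_continuousAt]
    rintro ⟨y, i⟩
    have h1 : F n =ᶠ[𝓝 (y, i)] fun p => (hIter R ((i.1 + n) / D) p.1, (F n (y, i)).2) := by
      have : ∀ᶠ p : Y × Z in 𝓝 (y, i), p.2 = i := by
        exact ((isOpen_discrete ({i} : Set Z)).preimage (continuous_snd : Continuous (Prod.snd : Y × Z → Z))).mem_nhds rfl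
      filter_upwards [this] with p hp
      simp only [F, hp]
    refine ContinuousAt.congr ?_ h1.symm
    exact (((continuous_hIter R _).comp continuous_fst).prodMk continuous_const).continuousAt
  have hm : MinimalTDS (ofAct F h0 ha hc) := by
    rintro ⟨y, i⟩
    rw [Metric.dense_iff]
    rintro ⟨y', i'⟩ ε hε
    obtain ⟨k, hk⟩ := near R hmin y y' hε
    refine ⟨_, ?_, ⟨D * k + i'.1 - i.1, rfl⟩⟩
    simp only [hIter_ofAct, F]
    have e : i.1 + (D * k + i'.1 - i.1) = i'.1 + D * k := by ring
    rw [Metric.mem_ball, Prod.dist_eq]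
    apply max_lt
    · simp only [e]
      rw [Int.add_mul_ediv_left _ _ hD.ne', Int.ediv_eq_zero_of_lt i'.2.1 i'.2.2, zero_add]
      exact hk
    · have : (⟨(i.1 + (D * k + i'.1 - i.1)) % D, Int.emod_nonneg _ hD.ne', Int.emod_lt_of_pos _ hD⟩ : Z) = i' := by
        apply Subtype.ext
        simp only [e]
        rw [Int.add_mul_emod_self_left]
        exact Int.emod_eq_of_lt i'.2.1 i'.2.2
      rw [this]
      simpa using hε
  obtain ⟨u, hu⟩ := hne
  let z0 : Z := ⟨0, le_rfl, hD⟩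
  obtain ⟨n, hn, ⟨y, i⟩, hy⟩ := hS (Y × Z) (ofAct F h0 ha hc) hm (U ×ˢ {z0})
    (hU.prod (isOpen_discrete _)) ⟨(u, z0), hu, rfl⟩
  simp only [Set.mem_iInter, Finset.mem_range, Set.mem_preimage, hIter_ofAct] at hy
  have hi : i = z0 := by
    have := hy 0 (by omega)
    rw [Nat.cast_zero, zero_mul, h0] at this
    exact this.2
  subst hi
  have h1 : n % D = 0 := by
    have := (hy 1 (by omega)).2
    simp only [Nat.cast_one, one_mul, F, z0, zero_add, Set.mem_singleton_iff] at this
    exact congrArg Subtype.val this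
  obtain ⟨m, rfl⟩ := Int.dvd_of_emod_eq_zero h1
  refine ⟨m, hn, y, ?_⟩
  simp only [Set.mem_iInter, Finset.mem_range, Set.mem_preimage]
  intro j hj
  have := (hy j hj).1
  simp only [F, z0, zero_add] at this
  rwa [mul_left_comm, Int.mul_ediv_cancel_left _ hD.ne'] at this

section
variable {X : Type} [MetricSpace X] [CompactSpace X] (T : X ≃ₜ X)

lemma diagRec {x : X} (hx : HIP T x) {d : ℕ} {S : Set ℤ} (hS : TopRecSet d S) {ρ : ℝ} (hρ : 0 < ρ) :
    ∃ m ∈ S, ∃ a : ℤ, ∀ i ≤ d, ∀ j < d,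
      dist (hIter T (((j : ℤ) + 1) * a + (i : ℤ) * (((j : ℤ) + 1) * m)) x) x < ρ := by
  let F : ℤ → (Fin d → X) → (Fin d → X) := fun n ζ j => hIter T (((j : ℕ) + 1 : ℤ) * n) (ζ j)
  have h0 : ∀ p, F 0 p = p := by
    intro p; funext j; simp [F, hIter_zero]
  have ha : ∀ m n p, F (m + n) p = F m (F n p) := by
    intro m n p; funext j
    simp only [F]
    rw [← hIter_add, mul_add]
  have hc : ∀ n, Continuous (F n) := fun n =>
    continuous_pi fun j => (continuous_hIter T _).comp (continuous_apply j)
  let z0 : Fin d → X := fun _ => x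
  let Y : Set (Fin d → X) := closure (Set.range fun n => F n z0)
  have hYcl : IsClosed Y := isClosed_closure
  haveI : CompactSpace Y := isCompact_iff_compactSpace.1 hYcl.isCompact
  have hYinv : ∀ n, ∀ ζ ∈ Y, F n ζ ∈ Y := by
    intro n ζ hζ
    have : Set.MapsTo (F n) (Set.range fun n => F n z0) (Set.range fun n => F n z0) := by
      rintro _ ⟨k, rfl⟩
      exact ⟨n + k, ha n k z0⟩
    exact this.closure (hc n) hζ
  let FY : ℤ → Y → Y := fun n ζ => ⟨F n ζ.1, hYinv n ζ.1 ζ.2⟩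
  have h0' : ∀ p, FY 0 p = p := fun p => Subtype.ext (h0 p.1)
  have ha' : ∀ m n p, FY (m + n) p = FY m (FY n p) := fun m n p => Subtype.ext (ha m n p.1)
  have hc' : ∀ n, Continuous (FY n) := fun n => ((hc n).comp continuous_subtype_val).subtype_mk _
  have hYx : ∀ ζ ∈ Y, ∀ ε > 0, ∃ n, dist (F n z0) ζ < ε := by
    intro ζ hζ ε hε
    obtain ⟨b, ⟨n, rfl⟩, hb⟩ := Metric.mem_closure_iff.1 hζ ε hε
    exact ⟨n, by rw [dist_comm]; exact hb⟩
  have hm : MinimalTDS (ofAct FY h0' ha' hc') := by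
    rintro ⟨ζ, hζ⟩
    rw [Metric.dense_iff]
    rintro ⟨ζ', hζ'⟩ ε hε
    obtain ⟨k, hk⟩ := hYx ζ' hζ' (ε / 2) (half_pos hε)
    obtain ⟨δ, hδ, h1⟩ := Metric.uniformContinuous_iff.1
      (CompactSpace.uniformContinuous_of_continuous (hc k)) (ε / 2) (half_pos hε)
    obtain ⟨n, hn⟩ := ret T hx (fun j : Fin d => AddMonoidHom.mulLeft ((j : ℕ) + 1 : ℤ)) ζ (by
      intro ε hε
      obtain ⟨n, hn⟩ := hYx ζ hζ ε hε
      exact ⟨n, (dist_pi_lt_iff hε).1 hn⟩) hδ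
    refine ⟨_, ?_, ⟨k + n, rfl⟩⟩
    simp only [hIter_ofAct, FY]
    rw [Metric.mem_ball, Subtype.dist_eq]
    change dist (F (k + n) ζ) ζ' < ε
    rw [ha]
    have h2 : dist (F n ζ) z0 < δ := (dist_pi_lt_iff hδ).2 hn
    have h3 := h1 h2
    linarith [dist_triangle (F k (F n ζ)) (F k z0) ζ']
  have hz0 : z0 ∈ Y := subset_closure ⟨0, h0 z0⟩
  obtain ⟨m, hmS, ⟨ζ, hζ⟩, hy⟩ := hS Y (ofAct FY h0' ha' hc') hm (Metric.ball ⟨z0, hz0⟩ (ρ / 2))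
    Metric.isOpen_ball ⟨_, Metric.mem_ball_self (half_pos hρ)⟩
  simp only [Set.mem_iInter, Finset.mem_range, Set.mem_preimage, hIter_ofAct, FY, Metric.mem_ball,
    Subtype.dist_eq] at hy
  have hev : ∀ᶠ ξ in 𝓝 ζ, ∀ i ∈ Finset.range (d + 1), dist (F ((i : ℤ) * m) ξ) z0 < ρ := by
    rw [Filter.eventually_all_finset]
    intro i hi
    have : Tendsto (fun ξ => dist (F ((i : ℤ) * m) ξ) z0) (𝓝 ζ) (𝓝 (dist (F ((i : ℤ) * m) ζ) z0)) :=
      ((hc _).dist continuous_const).tendsto ζ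
    exact this.eventually (gt_mem_nhds (lt_trans (hy i (Finset.mem_range.1 hi)) (half_lt_self hρ)))
  obtain ⟨δ, hδ, h1⟩ := Metric.eventually_nhds_iff.1 hev
  obtain ⟨a, hka⟩ := hYx ζ hζ δ hδ
  refine ⟨m, hmS, a, fun i hi j hj => ?_⟩
  have h2 := (dist_pi_lt_iff hρ).1 (h1 hka i (Finset.mem_range.2 (by omega))) ⟨j, hj⟩
  simp only [F, z0] at h2
  rw [← hIter_add] at h2
  convert h2 using 3
  ring

lemma key1 {x : X} {d : ℕ} (h : ∀ y : X, RPd T d x y → y = x) {ρ : ℝ} (hρ : 0 < ρ) :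
    ∃ δ > 0, ∀ (x' y' : X) (n : Fin d → ℤ), dist x x' < δ →
      (∀ e : Finset (Fin d), e.Nonempty →
        dist (hIter T (∑ i ∈ e, n i) x') (hIter T (∑ i ∈ e, n i) y') < δ) → dist x y' < ρ := by
  by_contra! H
  choose x' y' n h1 h2 h3 using fun k : ℕ => H (1 / ((k : ℝ) + 1)) (by positivity)
  obtain ⟨y, hy⟩ := exists_lim y' (Ultrafilter.of atTop)
  have hyx : y = x := by
    apply h
    intro δ hδ
    have e1 : ∀ᶠ k : ℕ in (Ultrafilter.of atTop : Ultrafilter ℕ), 1 / ((k : ℝ) + 1) < δ :=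
      (tendsto_one_div_add_atTop_nhds_zero_nat.mono_left (Ultrafilter.of_le _)).eventually (gt_mem_nhds hδ)
    obtain ⟨k, hk1, hk2⟩ := (e1.and (hy.eventually (Metric.ball_mem_nhds _ hδ))).exists
    refine ⟨x' k, y' k, n k, (h1 k).trans hk1, ?_, fun e he => (h2 k e he).trans hk1⟩
    rw [dist_comm]; exact hk2
  subst hyx
  obtain ⟨k, hk⟩ := (hy.eventually (Metric.ball_mem_nhds _ hρ)).exists
  have := h3 k
  rw [dist_comm] at this
  exact absurd hk (not_lt.2 this)

lemma ext1 {x : X} {d : ℕ} (h : ∀ y : X, RPd T d x y → y = x) {ρ : ℝ} (hρ : 0 < ρ) :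
    ∃ δ > 0, δ ≤ ρ ∧ ∀ b n : ℤ, (∀ i : ℕ, i ≤ d → dist (hIter T (b + i * n) x) x < δ) →
      dist (hIter T (b + (d + 1) * n) x) x < ρ := by
  obtain ⟨δ, hδ, h1⟩ := key1 T h hρ
  refine ⟨min (δ / 2) ρ, lt_min (half_pos hδ) hρ, min_le_right _ _, fun b n hb => ?_⟩
  rw [dist_comm]
  have hb' : ∀ i : ℕ, i ≤ d → dist (hIter T (b + i * n) x) x < δ / 2 := fun i hi =>
    lt_of_lt_of_le (hb i hi) (min_le_left _ _)
  apply h1 (hIter T (b + d * n) x) _ (fun _ => -n)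
  · rw [dist_comm]
    linarith [hb' d le_rfl]
  · intro e he
    have hc1 : 1 ≤ e.card := he.card_pos
    have hc2 : e.card ≤ d := by simpa using Finset.card_le_univ e
    rw [Finset.sum_const, nsmul_eq_mul, ← hIter_add, ← hIter_add]
    have e1 : (e.card : ℤ) * -n + (b + d * n) = b + ((d - e.card : ℕ) : ℤ) * n := by
      push_cast [hc2]; ring
    have e2 : (e.card : ℤ) * -n + (b + (d + 1) * n) = b + ((d + 1 - e.card : ℕ) : ℤ) * n := by
      push_cast [hc2.trans (Nat.le_succ d)]; ring
    rw [e1, e2]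
    exact (dist_triangle_right _ _ x).trans_lt
      (by linarith [hb' (d - e.card) (by omega), hb' (d + 1 - e.card) (by omega)])

lemma extL {x : X} {d : ℕ} (h : ∀ y : X, RPd T d x y → y = x) (L : ℕ) : ∀ {ρ : ℝ}, 0 < ρ →
    ∃ δ > 0, ∀ b n : ℤ, (∀ i : ℕ, i ≤ d → dist (hIter T (b + i * n) x) x < δ) →
      ∀ i : ℕ, i ≤ L → dist (hIter T (b + i * n) x) x < ρ := by
  induction L with
  | zero =>
    intro ρ hρ
    refine ⟨ρ, hρ, fun b n hb i hi => hb i (by omega)⟩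
  | succ L ih =>
    intro ρ hρ
    obtain ⟨δ1, h1, h2, h3⟩ := ext1 T h hρ
    obtain ⟨δ2, h4, h5⟩ := ih h1
    refine ⟨min ρ δ2, lt_min hρ h4, fun b n hb i hi => ?_⟩
    have h6 := h5 b n fun i hi => lt_of_lt_of_le (hb i hi) (min_le_right _ _)
    rcases Nat.lt_or_ge L i with hL | hL
    · obtain rfl : i = L + 1 := by omega
      rcases Nat.lt_or_ge L d with hd | hd
      · exact lt_of_lt_of_le (hb _ hd) (min_le_left _ _)
      · have h7 := h3 (b + ((L - d : ℕ) : ℤ) * n) n (by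
          intro i hi
          have := h6 (L - d + i) (by omega)
          convert this using 3
          push_cast; ring)
        convert h7 using 3
        push_cast [hd]; ring
    · exact lt_of_lt_of_le (h6 i hL) h2

lemma part13 {x : X} {d : ℕ} (hd : 1 ≤ d) (h : ∀ y : X, RPd T d x y → y = x) (V : Set X)
    (hV : IsOpen V) (hxV : x ∈ V) (S : Set ℤ) (hS : TopRecSet d S) : (Nset T x V ∩ S).Nonempty := by
  have hx := hip_of_aa T h
  obtain ⟨ρ, hρ, hρV⟩ := Metric.isOpen_iff.1 hV x hxV
  obtain ⟨δ, hδ, h1⟩ := key1 T h hρ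
  obtain ⟨δ2, hδ2, h2⟩ := extL T h d.factorial (half_pos hδ)
  obtain ⟨m, hm, a, h3⟩ := diagRec T hx (tower hd hS (d.factorial : ℤ)
    (by exact_mod_cast d.factorial_pos)) hδ2
  refine ⟨(d.factorial : ℤ) * m, ?_, hm⟩
  apply hρV
  rw [Metric.mem_ball, dist_comm]
  apply h1 x _ (fun _ => a) (by simpa using hδ)
  intro e he
  have hc1 : 1 ≤ e.card := he.card_pos
  have hc2 : e.card ≤ d := by simpa using Finset.card_le_univ e
  rw [Finset.sum_const, nsmul_eq_mul, ← hIter_add]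
  have h4 := h2 ((e.card : ℤ) * a) ((e.card : ℤ) * m) (by
    intro i hi
    have := h3 i hi (e.card - 1) (by omega)
    convert this using 5 <;> push_cast [hc1] <;> ring)
  obtain ⟨q, hq⟩ := Nat.dvd_factorial hc1 hc2
  have h5 := h4 0 (by omega)
  have h6 := h4 q (by rw [hq]; exact Nat.le_mul_of_pos_left _ hc1)
  have e6 : (e.card : ℤ) * a + (q : ℤ) * ((e.card : ℤ) * m) = (e.card : ℤ) * a + (d.factorial : ℤ) * m := by
    rw [hq]; push_cast; ring
  rw [e6] at h6
  rw [Nat.cast_zero, zero_mul, add_zero] at h5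
  exact (dist_triangle_right _ _ x).trans_lt (by linarith)

end
end DHJ


end

/-- `x` is a `d`-step almost automorphic point iff `N(x, V)` meets every set of
`d`-recurrence, iff `N(x, V)` meets every set of `d`-topological recurrence. -/
theorem statement19 {X : Type} [MetricSpace X] [CompactSpace X] (T : X ≃ₜ X)
    (hmin : MinimalTDS T) (x : X) (d : ℕ) (hd : 1 ≤ d) :
    ((∀ y : X, RPd T d x y → y = x) ↔
      ∀ V : Set X, IsOpen V → x ∈ V →
        ∀ S : Set ℤ, MeasRecSet d S → (Nset T x V ∩ S).Nonempty) ∧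
    ((∀ y : X, RPd T d x y → y = x) ↔
      ∀ V : Set X, IsOpen V → x ∈ V →
        ∀ S : Set ℤ, TopRecSet d S → (Nset T x V ∩ S).Nonempty) := by
  have h13 := fun h : ∀ y : X, RPd T d x y → y = x => DHJ.part13 T hd h
  have h32 : (∀ V : Set X, IsOpen V → x ∈ V → ∀ S : Set ℤ, TopRecSet d S →
      (Nset T x V ∩ S).Nonempty) → ∀ V : Set X, IsOpen V → x ∈ V → ∀ S : Set ℤ,
      MeasRecSet d S → (Nset T x V ∩ S).Nonempty :=
    fun h V hV hx S hS => h V hV hx S (DHJ.top_of_meas hS)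
  exact ⟨⟨fun h => h32 (h13 h), fun h => DHJ.part21 T hmin h⟩,
    ⟨h13, fun h => DHJ.part21 T hmin (h32 h)⟩⟩
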